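/- arXiv:1610.04253 — 3 statements merged into one kernel-verified Lean document; each statement's English description precedes it below -/
import Mathlib

section
/- Uniformly for α ∈ (0,1), the number of n ≤ x with log τ(n) ≤ α·(log 2)·(log log x) is ≪ x (log x)^{−B(α)}, where B(α) = α log α − α + 1 > 0. -/
theorem two_pow_omega_le {n : ℕ} (hn : n ≠ 0) : 2 ^ (n.primeFactors.card) ≤ n.divisors.card := by
  rw [Nat.card_divisors hn, ← Finset.prod_const]
  apply Finset.prod_le_prod' 
  intro p hp
  have := (Nat.prime_of_mem_primeFactors hp).factorization_pos_of_dvd hn (Nat.dvd_of_mem_primeFactors hp)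
  omega

noncomputable def FF (z : ℝ) : ArithmeticFunction ℝ :=
  ⟨fun n => if n = 0 then 0 else z ^ n.primeFactors.card, by simp⟩

theorem FF_apply (z : ℝ) {n : ℕ} (hn : n ≠ 0) : FF z n = z ^ n.primeFactors.card := by
  simp [FF, hn]

theorem FF_nonneg {z : ℝ} (hz : 0 ≤ z) (n : ℕ) : 0 ≤ FF z n := by
  by_cases hn : n = 0
  · simp [hn]
  · rw [FF_apply z hn]; positivity

theorem FF_le_of_dvd {z : ℝ} (hz : 0 ≤ z) (hz1 : z ≤ 1) {m n : ℕ} (hn : n ≠ 0) (h : m ∣ n) :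
    FF z n ≤ FF z m := by
  have hm : m ≠ 0 := fun h0 => hn (by simpa [h0] using h)
  rw [FF_apply z hn, FF_apply z hm]
  exact pow_le_pow_of_le_one hz hz1 (Finset.card_le_card (Nat.primeFactors_mono h hn))

theorem log_mean {z : ℝ} (hz : 0 ≤ z) (hz1 : z ≤ 1) (N : ℕ) :
    ∑ n ∈ Finset.Ioc 0 N, FF z n * Real.log n ≤
      ∑ n ∈ Finset.Ioc 0 N, FF z n * Chebyshev.psi ((N / n : ℕ) : ℝ) := by
  have h := ArithmeticFunction.sum_Ioc_mul_eq_sum_sum (FF z) ArithmeticFunction.vonMangoldt N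
  have h2 : ∑ n ∈ Finset.Ioc 0 N, FF z n * Chebyshev.psi ((N / n : ℕ) : ℝ) =
      ∑ n ∈ Finset.Ioc 0 N, FF z n * ∑ m ∈ Finset.Ioc 0 (N / n), ArithmeticFunction.vonMangoldt m := by
    simp [Chebyshev.psi]
  rw [h2, ← h]
  apply Finset.sum_le_sum
  intro n hn
  have hn0 : n ≠ 0 := by simp at hn; omega
  rw [ArithmeticFunction.mul_apply, ← ArithmeticFunction.vonMangoldt_sum, Finset.mul_sum,
    ← Nat.sum_divisorsAntidiagonal' (f := fun a b => FF z n * ArithmeticFunction.vonMangoldt b)]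
  apply Finset.sum_le_sum
  intro x hx
  apply mul_le_mul_of_nonneg_right _ ArithmeticFunction.vonMangoldt_nonneg
  exact FF_le_of_dvd hz hz1 hn0 (Dvd.intro _ (Nat.mem_divisorsAntidiagonal.1 hx).1)

theorem mean_bound {z : ℝ} (hz : 0 ≤ z) (hz1 : z ≤ 1) {x : ℝ} (hx : 3 ≤ x) :
    Real.log x * ∑ n ∈ Finset.Ioc 0 ⌊x⌋₊, FF z n ≤
      (Real.log 4 + 5) * x * ∑ n ∈ Finset.Ioc 0 ⌊x⌋₊, FF z n * (n : ℝ)⁻¹ := by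
  have h1 := log_mean hz hz1 ⌊x⌋₊
  have key : Real.log x * ∑ n ∈ Finset.Ioc 0 ⌊x⌋₊, FF z n ≤
      ∑ n ∈ Finset.Ioc 0 ⌊x⌋₊, FF z n * Real.log n + 
      ∑ n ∈ Finset.Ioc 0 ⌊x⌋₊, FF z n * (x * (n : ℝ)⁻¹) := by
    rw [Finset.mul_sum, ← Finset.sum_add_distrib]
    apply Finset.sum_le_sum
    intro n hn
    have hn0 : 0 < n := by simp at hn; omega
    have hn1 : (0:ℝ) < n := by exact_mod_cast hn0
    rw [← mul_add, mul_comm]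
    apply mul_le_mul_of_nonneg_left _ (FF_nonneg hz n)
    have := Real.log_le_self (x := x * (n:ℝ)⁻¹) (by positivity)
    rw [Real.log_mul (by linarith) (by positivity), Real.log_inv] at this
    linarith
  have h2 : ∑ n ∈ Finset.Ioc 0 ⌊x⌋₊, FF z n * Chebyshev.psi ((⌊x⌋₊ / n : ℕ) : ℝ) ≤
      ∑ n ∈ Finset.Ioc 0 ⌊x⌋₊, FF z n * ((Real.log 4 + 4) * (x * (n : ℝ)⁻¹)) := by
    apply Finset.sum_le_sum
    intro n hn
    apply mul_le_mul_of_nonneg_left _ (FF_nonneg hz n)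
    refine (Chebyshev.psi_le_const_mul_self (by positivity)).trans ?_
    have : (0:ℝ) ≤ Real.log 4 := Real.log_nonneg (by norm_num)
    apply mul_le_mul_of_nonneg_left _ (by linarith)
    rw [← div_eq_mul_inv]
    refine Nat.cast_div_le.trans ?_
    gcongr
    exact Nat.floor_le (by linarith)
  refine (key.trans (add_le_add_left (h1.trans h2) _)).trans (le_of_eq ?_)
  rw [Finset.mul_sum, ← Finset.sum_add_distrib]
  apply Finset.sum_congr rfl
  intros
  ring

theorem zeta_prod {σ : ℝ} (hσ : 1 < σ) (N : ℕ) :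
    ∏ p ∈ N.primesBelow, (1 - (p : ℝ) ^ (-σ))⁻¹ ≤ 1 + 1 / (σ - 1) := by
  let f : ℕ →* ℝ := 
    { toFun := fun n => (n : ℝ) ^ (-σ)
      map_one' := by simp
      map_mul' := fun a b => by
        simp only [Nat.cast_mul]
        exact Real.mul_rpow (by positivity) (by positivity) }
  have hsum : Summable f := Real.summable_nat_rpow.2 (by linarith)
  have h := EulerProduct.prod_primesBelow_geometric_eq_tsum_smoothNumbers hsum N
  have hf : ∀ n : ℕ, f n = (n : ℝ) ^ (-σ) := fun n => rfl
  simp only [← hf]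
  rw [h]
  refine (hsum.tsum_subtype_le (fun n => f n) _ (fun n => by rw [hf]; positivity)).trans ?_
  rw [hsum.tsum_eq_zero_add]
  have h3 := ZetaAsymptotics.zeta_limit_aux1 hσ
  have h4 : 0 ≤ ZetaAsymptotics.termTSum σ := tsum_nonneg (fun n => ZetaAsymptotics.term_nonneg _ _)
  have h5 : ∑' n : ℕ, f (n + 1) = ∑' n : ℕ, 1 / (n + 1 : ℝ) ^ σ := by
    congr 1; ext n
    rw [hf, Real.rpow_neg (by positivity)]; simp
  have h6 : f 0 = 0 := by rw [hf]; simp; rw [Real.zero_rpow (by linarith)]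
  rw [h5, h6]
  nlinarith

theorem FF_prod {z : ℝ} (hz : 0 ≤ z) {σ : ℝ} (hσ : 1 < σ) (N : ℕ) :
    ∑ n ∈ Finset.Ioc 0 N, FF z n * (n : ℝ) ^ (-σ) ≤
      ∏ p ∈ (N + 1).primesBelow, (1 + z * ((1 - (p : ℝ) ^ (-σ))⁻¹ - 1)) := by
  obtain ⟨g, hg⟩ : ∃ g : ℕ → ℝ, ∀ n, g n = FF z n * (n : ℝ) ^ (-σ) := ⟨_, fun _ => rfl⟩
  have g0 : ∀ n, 0 ≤ g n := fun n => by
    rw [hg]; exact mul_nonneg (FF_nonneg hz n) (by positivity)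
  have g1 : g 1 = 1 := by simp [hg, FF_apply]
  have gmul : ∀ {m n : ℕ}, Nat.Coprime m n → g (m * n) = g m * g n := by
    intro m n h
    simp only [hg]
    by_cases hm : m = 0
    · simp [hm]
    by_cases hn : n = 0
    · simp [hn]
    rw [FF_apply z hm, FF_apply z hn, FF_apply z (mul_ne_zero hm hn), h.primeFactors_mul,
      Finset.card_union_of_disjoint h.disjoint_primeFactors, pow_add, Nat.cast_mul,
      Real.mul_rpow (by positivity) (by positivity)]
    ring
  have gp : ∀ {p : ℕ}, p.Prime → HasSum (fun e : ℕ => g (p ^ e))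
      (1 + z * ((1 - (p : ℝ) ^ (-σ))⁻¹ - 1)) := by
    intro p hp
    have hu1 : (p : ℝ) ^ (-σ) < 1 :=
      Real.rpow_lt_one_of_one_lt_of_neg (by exact_mod_cast hp.one_lt) (by linarith)
    have hu0 : 0 ≤ (p : ℝ) ^ (-σ) := by positivity
    have h1 := hasSum_geometric_of_lt_one hu0 hu1
    have h2 := (h1.mul_left z).add (hasSum_ite_eq (0 : ℕ) (1 - z))
    have e2 : z * (1 - (p : ℝ) ^ (-σ))⁻¹ + (1 - z) =
        1 + z * ((1 - (p : ℝ) ^ (-σ))⁻¹ - 1) := by ring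
    rw [e2] at h2
    have e3 : (fun e : ℕ => g (p ^ e)) =
        fun b : ℕ => z * ((p : ℝ) ^ (-σ)) ^ b + if b = 0 then 1 - z else 0 := by
      funext e
      rcases Nat.eq_zero_or_pos e with rfl | he
      · simp [g1]
      · have hpe : p ^ e ≠ 0 := pow_ne_zero _ hp.ne_zero
        simp only [hg]
        rw [FF_apply z hpe, Nat.primeFactors_prime_pow he.ne' hp, if_neg he.ne', Nat.cast_pow,
          ← Real.rpow_natCast, ← Real.rpow_natCast, ← Real.rpow_mul (by positivity),
          ← Real.rpow_natCast, ← Real.rpow_mul (by positivity)]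
        simp [mul_comm]
    rw [e3]
    exact h2
  have gs : ∀ {p : ℕ}, p.Prime → Summable (fun e : ℕ => ‖g (p ^ e)‖) := by
    intro p hp
    exact (gp hp).summable.norm
  have H := EulerProduct.summable_and_hasSum_smoothNumbers_prod_primesBelow_tsum (f := g) g1 gmul
    gs (N + 1)
  have e1 : ∏ p ∈ (N + 1).primesBelow, (1 + z * ((1 - (p : ℝ) ^ (-σ))⁻¹ - 1)) =
      ∏ p ∈ (N + 1).primesBelow, ∑' e : ℕ, g (p ^ e) :=
    Finset.prod_congr rfl fun p hp => (gp (Nat.prime_of_mem_primesBelow hp)).tsum_eq.symm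
  rw [e1]
  have H2 := hasSum_subtype_iff_indicator.1 H.2
  have : ∑ n ∈ Finset.Ioc 0 N, FF z n * (n : ℝ) ^ (-σ) =
    ∑ n ∈ Finset.Ioc 0 N, (Nat.smoothNumbers (N+1)).indicator g n := by
    apply Finset.sum_congr rfl
    intro n hn
    rw [Set.indicator_of_mem, hg]
    simp at hn
    exact Nat.mem_smoothNumbers_of_lt hn.1 (by omega)
  rw [this]
  exact sum_le_hasSum _ (fun n _ => Set.indicator_nonneg (fun n _ => g0 n) n) H2

theorem exists_inv_sq : ∃ c : ℝ, 0 ≤ c ∧ ∀ N : ℕ, ∀ σ : ℝ, 1 < σ →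
    ∑ p ∈ N.primesBelow, ((1 - (p : ℝ) ^ (-σ))⁻¹ - 1) ^ 2 ≤ c := by
  have hs : Summable (fun n : ℕ => 4 * ((n : ℝ) ^ 2)⁻¹) :=
    (Real.summable_nat_pow_inv.2 (by norm_num)).mul_left 4
  refine ⟨∑' n : ℕ, 4 * ((n : ℝ) ^ 2)⁻¹, tsum_nonneg fun n => by positivity, fun N σ hσ => ?_⟩
  refine le_trans (Finset.sum_le_sum ?_) (hs.sum_le_tsum N.primesBelow fun n _ => by positivity)
  intro p hp
  have hp2 : (2:ℝ) ≤ p := by exact_mod_cast (Nat.prime_of_mem_primesBelow hp).two_le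
  have hu : (p : ℝ) ^ (-σ) ≤ (p:ℝ)⁻¹ := by
    rw [← Real.rpow_neg_one]
    exact Real.rpow_le_rpow_of_exponent_le (by linarith) (by linarith)
  have hi : (p:ℝ)⁻¹ ≤ 2⁻¹ := by gcongr
  have hu0 : 0 ≤ (p : ℝ) ^ (-σ) := by positivity
  generalize (p : ℝ) ^ (-σ) = u at *
  have h1 : 0 < 1 - u := by linarith
  have h2 : (1 - u)⁻¹ - 1 = u / (1 - u) := by field_simp; ring
  have h3 : u / (1 - u) ≤ 2 * (p:ℝ)⁻¹ := by
    rw [div_le_iff₀ h1]; nlinarith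
  have h4 : 0 ≤ u / (1 - u) := by positivity
  rw [h2, ← inv_pow]
  nlinarith

theorem sum_bound : ∃ C : ℝ, 0 < C ∧ ∀ z : ℝ, 0 ≤ z → z ≤ 1 → ∀ x : ℝ, 3 ≤ x →
    ∑ n ∈ Finset.Ioc 0 ⌊x⌋₊, FF z n * (n : ℝ)⁻¹ ≤ C * (Real.log x) ^ z := by
  obtain ⟨c, hc, hcs⟩ := exists_inv_sq
  refine ⟨Real.exp 1 * (2 * Real.exp c), by positivity, fun z hz hz1 x hx => ?_⟩
  have hL : 1 ≤ Real.log x := by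
    rw [Real.le_log_iff_exp_le (by linarith)]
    linarith [Real.exp_one_lt_d9]
  set L := Real.log x with hLdef
  have hσ : 1 < 1 + 1 / L := by have : 0 < 1 / L := by positivity
                                linarith
  set σ := 1 + 1 / L with hσdef
  have s1 : ∑ n ∈ Finset.Ioc 0 ⌊x⌋₊, FF z n * (n : ℝ)⁻¹ ≤
      Real.exp 1 * ∑ n ∈ Finset.Ioc 0 ⌊x⌋₊, FF z n * (n : ℝ) ^ (-σ) := by
    rw [Finset.mul_sum]
    apply Finset.sum_le_sum
    intro n hn
    simp only [Finset.mem_Ioc] at hn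
    have hn1 : (0:ℝ) < n := by exact_mod_cast hn.1
    have hnx : (n:ℝ) ≤ x := (Nat.le_floor_iff (by linarith)).1 hn.2
    rw [mul_left_comm]
    apply mul_le_mul_of_nonneg_left _ (FF_nonneg hz n)
    have e : (n:ℝ) ^ (-σ) = (n:ℝ)⁻¹ * Real.exp (-(Real.log n / L)) := by
      rw [hσdef, neg_add, Real.rpow_add hn1, Real.rpow_neg_one, Real.rpow_def_of_pos hn1]
      congr 2; ring
    rw [e, mul_left_comm, ← Real.exp_add]
    apply le_mul_of_one_le_right (by positivity)
    apply Real.one_le_exp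
    have : Real.log n / L ≤ 1 := by
      rw [div_le_one (by linarith)]
      exact Real.log_le_log hn1 hnx
    linarith
  have s2 := FF_prod hz hσ ⌊x⌋₊
  set P := (⌊x⌋₊ + 1).primesBelow with hP
  have s3 := zeta_prod hσ (⌊x⌋₊ + 1)
  have s4 := hcs (⌊x⌋₊ + 1) σ hσ
  rw [← hP] at s3 s4
  have hw : ∀ p ∈ P, 0 ≤ (1 - (p : ℝ) ^ (-σ))⁻¹ - 1 := by
    intro p hp
    have h1 : (1:ℝ) < p := by exact_mod_cast (Nat.prime_of_mem_primesBelow hp).one_lt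
    have hu1 : (p : ℝ) ^ (-σ) < 1 :=
      Real.rpow_lt_one_of_one_lt_of_neg h1 (by linarith)
    have hu0 : 0 ≤ (p : ℝ) ^ (-σ) := by positivity
    have := (one_le_inv₀ (by linarith : 0 < 1 - (p : ℝ) ^ (-σ))).2 (by linarith)
    linarith
  have s5 : ∏ p ∈ P, (1 + z * ((1 - (p : ℝ) ^ (-σ))⁻¹ - 1)) ≤
      ∏ p ∈ P, (((1 - (p : ℝ) ^ (-σ))⁻¹) ^ z * Real.exp (((1 - (p : ℝ) ^ (-σ))⁻¹ - 1) ^ 2)) := by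
    apply Finset.prod_le_prod
    · intro p hp
      have := mul_nonneg hz (hw p hp)
      linarith
    · intro p hp
      have h0 := hw p hp
      generalize hv : (1 - (p : ℝ) ^ (-σ))⁻¹ = v at *
      have hvp : 0 < v := by linarith
      rw [Real.rpow_def_of_pos hvp, ← Real.exp_add]
      have h1 : z * (v - 1) ≤ Real.log v * z + (v - 1) ^ 2 := by
        have h2 := Real.one_sub_inv_le_log_of_pos hvp
        have h3 : v - 1 - (v - 1) ^ 2 ≤ 1 - v⁻¹ := by
          have : 1 - v⁻¹ - (v - 1 - (v - 1) ^ 2) = (v - 1) ^ 3 / v := by field_simp; ring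
          have : 0 ≤ (v - 1) ^ 3 / v := by positivity
          linarith
        nlinarith [sq_nonneg (v - 1)]
      have := Real.add_one_le_exp (z * (v - 1))
      have := Real.exp_le_exp.2 h1
      linarith
  have s6 : ∏ p ∈ P, (((1 - (p : ℝ) ^ (-σ))⁻¹) ^ z * Real.exp (((1 - (p : ℝ) ^ (-σ))⁻¹ - 1) ^ 2))
      ≤ (2 * L ^ z) * Real.exp c := by
    rw [Finset.prod_mul_distrib, ← Real.exp_sum, Real.finsetProd_rpow _ _ (fun p hp => by linarith [hw p hp])]
    apply mul_le_mul _ (Real.exp_le_exp.2 s4) (by positivity) (by positivity)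
    have h1 : ∏ p ∈ P, (1 - (p : ℝ) ^ (-σ))⁻¹ ≤ 2 * L := by
      refine s3.trans ?_
      have : 1 / (σ - 1) = L := by rw [hσdef]; simp
      rw [this]; linarith
    refine (Real.rpow_le_rpow (Finset.prod_nonneg fun p hp => by linarith [hw p hp]) h1 hz).trans ?_
    rw [Real.mul_rpow (by norm_num) (by linarith)]
    apply mul_le_mul_of_nonneg_right _ (by positivity)
    calc (2:ℝ) ^ z ≤ 2 ^ (1:ℝ) := Real.rpow_le_rpow_of_exponent_le (by norm_num) hz1
      _ = 2 := by simp
  calc _ ≤ _ := s1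
    _ ≤ Real.exp 1 * ((2 * L ^ z) * Real.exp c) := by
      apply mul_le_mul_of_nonneg_left _ (by positivity)
      exact s2.trans (s5.trans s6)
    _ = _ := by ring

theorem count_small_tau_le : ∃ C > 0, ∀ x : ℝ, 3 ≤ x → ∀ α : ℝ, 0 < α → α < 1 →
    (((Finset.Icc 1 ⌊x⌋₊).filter (fun n =>
        Real.log (n.divisors.card) ≤ α * Real.log 2 * Real.log (Real.log x))).card : ℝ) ≤
      C * x * (Real.log x) ^ (-(α * Real.log α - α + 1)) := by
  obtain ⟨C, hC, hb⟩ := sum_bound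
  have h4 : (0:ℝ) ≤ Real.log 4 := Real.log_nonneg (by norm_num)
  refine ⟨(Real.log 4 + 5) * C, by positivity, fun x hx α hα hα1 => ?_⟩
  have hL : 1 ≤ Real.log x := by
    rw [Real.le_log_iff_exp_le (by linarith)]
    linarith [Real.exp_one_lt_d9]
  have m := mean_bound hα.le hα1.le hx
  have b := hb α hα.le hα1.le x hx
  set L := Real.log x with hLdef
  have hLp : 0 < L := by linarith
  have hmain : ∑ n ∈ Finset.Ioc 0 ⌊x⌋₊, FF α n ≤ (Real.log 4 + 5) * C * x * (L ^ α * L⁻¹) := by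
    have : L * ∑ n ∈ Finset.Ioc 0 ⌊x⌋₊, FF α n ≤ (Real.log 4 + 5) * x * (C * L ^ α) :=
      m.trans (mul_le_mul_of_nonneg_left b (by positivity))
    rw [← le_div_iff₀' hLp] at this
    refine this.trans (le_of_eq ?_)
    rw [div_eq_mul_inv]; ring
  have hcount : (((Finset.Icc 1 ⌊x⌋₊).filter (fun n =>
        Real.log (n.divisors.card) ≤ α * Real.log 2 * Real.log L)).card : ℝ) *
        L ^ (α * Real.log α) ≤ ∑ n ∈ Finset.Ioc 0 ⌊x⌋₊, FF α n := by
    rw [← nsmul_eq_mul]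
    refine (Finset.card_nsmul_le_sum _ (FF α) _ ?_).trans
      (Finset.sum_le_sum_of_subset_of_nonneg ?_ (fun n _ _ => FF_nonneg hα.le n))
    · intro n hn
      simp only [Finset.mem_filter, Finset.mem_Icc] at hn
      have hn0 : n ≠ 0 := by omega
      rw [FF_apply α hn0, ← Real.rpow_natCast, Real.rpow_def_of_pos hα, Real.rpow_def_of_pos hLp,
        Real.exp_le_exp]
      have h1 : (2:ℝ) ^ n.primeFactors.card ≤ n.divisors.card := by
        exact_mod_cast two_pow_omega_le hn0
      have h2 := Real.log_le_log (by positivity) h1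
      rw [Real.log_pow] at h2
      have l2 : 0 < Real.log 2 := Real.log_pos (by norm_num)
      have h3 : (n.primeFactors.card : ℝ) ≤ α * Real.log L := by
        have := h2.trans hn.2
        nlinarith
      have := mul_le_mul_of_nonpos_left h3 (Real.log_neg hα hα1).le
      linarith
    · intro n hn
      simp only [Finset.mem_filter, Finset.mem_Icc] at hn
      simp only [Finset.mem_Ioc]
      omega
  have hfin := hcount.trans hmain
  have hp : 0 < L ^ (α * Real.log α) := by positivity
  rw [← le_div_iff₀ hp] at hfin
  refine hfin.trans (le_of_eq ?_)
  have : L ^ (-(α * Real.log α - α + 1)) = L ^ α * L⁻¹ / L ^ (α * Real.log α) := by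
    rw [← Real.rpow_neg_one, ← Real.rpow_add hLp, ← Real.rpow_sub hLp]
    congr 1; ring
  rw [this]; ring
end

section
/- Fix an integer s ≥ 1. As x → ∞, the number of n ≤ x that are products of exactly s distinct primes (i.e., squarefree with ω(n) = s) is asymptotic to (1/(s−1)!) · x (log log x)^{s−1} / log x. -/
namespace LandauPNT
open MeasureTheory Filter Topology Set

lemma exists_G : ∃ G : ℂ → ℂ, ContinuousOn G {s | 1 ≤ s.re} ∧
    ∀ s : ℂ, 1 < s.re →
      LSeries (fun n => ((ArithmeticFunction.vonMangoldt n : ℝ) : ℂ)) s = G s + 1 / (s - 1) := by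
  refine ⟨ArithmeticFunction.vonMangoldt.LFunctionResidueClassAux (1 : ZMod 1),
    ArithmeticFunction.vonMangoldt.continuousOn_LFunctionResidueClassAux _, fun s hs => ?_⟩
  have h := ArithmeticFunction.vonMangoldt.eqOn_LFunctionResidueClassAux
    (a := (1 : ZMod 1)) isUnit_one hs
  rw [h]
  have h2 : (fun n => ((ArithmeticFunction.vonMangoldt.residueClass (1 : ZMod 1) n : ℝ) : ℂ)) =
      fun n => ((ArithmeticFunction.vonMangoldt n : ℝ) : ℂ) := by
    funext n
    congr 1
    unfold ArithmeticFunction.vonMangoldt.residueClass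
    apply Set.indicator_of_mem
    exact Subsingleton.elim _ _
  simp [h2]

/-- normalised error term -/
noncomputable def aa (v : ℝ) : ℝ := Chebyshev.psi (Real.exp v) * Real.exp (-v) - 1

lemma aa_meas : Measurable aa := by
  unfold aa
  exact ((Chebyshev.psi_mono.measurable.comp Real.measurable_exp).mul
    (Real.measurable_exp.comp measurable_neg)).sub measurable_const

lemma aa_bound (v : ℝ) : |aa v| ≤ 10 := by
  unfold aa
  have h1 := Chebyshev.psi_le_const_mul_self (Real.exp_pos v).le
  have h0 := Chebyshev.psi_nonneg (Real.exp v)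
  have h2 : Real.log 4 ≤ 4 := by
    have := Real.log_le_sub_one_of_pos (show (0:ℝ) < 4 by norm_num)
    linarith
  have h3 : Chebyshev.psi (Real.exp v) * Real.exp (-v) ≤ Real.log 4 + 4 := by
    rw [Real.exp_neg, ← div_eq_mul_inv, div_le_iff₀ (Real.exp_pos v)]
    exact h1
  have h4 : 0 ≤ Chebyshev.psi (Real.exp v) * Real.exp (-v) := by positivity
  rw [abs_le]
  constructor <;> linarith

lemma aa_integrable {z : ℂ} (hz : 0 < z.re) :
    IntegrableOn (fun v : ℝ => (aa v : ℂ) * Complex.exp (-z * v)) (Ioi 0) := by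
  have h := integrableOn_exp_mul_complex_Ioi (a := -z) (by simpa using hz) 0
  refine Integrable.bdd_mul (c := 10) h ?_ ?_
  · exact (Complex.measurable_ofReal.comp aa_meas).aestronglyMeasurable
  · exact Eventually.of_forall fun v => by simpa using aa_bound v

lemma psi_mellin {s : ℂ} (hs : 1 < s.re) :
    LSeries (fun n => ((ArithmeticFunction.vonMangoldt n : ℝ) : ℂ)) s =
      s * ∫ v in Ioi (0:ℝ), ((Chebyshev.psi (Real.exp v) * Real.exp (-v) : ℝ) : ℂ)
        * Complex.exp (-(s - 1) * v) := by
  rw [LSeries_eq_mul_integral_of_nonneg (r := 1) _ zero_le_one hs ?_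
    (fun n => ArithmeticFunction.vonMangoldt_nonneg)]
  · congr 1
    have himg : Real.exp '' Ioi 0 = Ioi 1 := by
      ext y
      simp only [mem_image, mem_Ioi]
      constructor
      · rintro ⟨x, hx, rfl⟩; exact Real.one_lt_exp_iff.2 hx
      · intro hy
        exact ⟨Real.log y, Real.log_pos hy, Real.exp_log (by linarith)⟩
    rw [← himg, integral_image_eq_integral_abs_deriv_smul (f' := Real.exp) measurableSet_Ioi
      (fun x _ => (Real.hasDerivAt_exp x).hasDerivWithinAt) Real.exp_injective.injOn]
    refine setIntegral_congr_fun measurableSet_Ioi fun v _ => ?_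
    rw [abs_of_pos (Real.exp_pos v), Chebyshev.psi_eq_sum_Icc, Complex.real_smul,
      Complex.cpow_def_of_ne_zero (by exact_mod_cast (Real.exp_pos v).ne'),
      ← Complex.ofReal_log (Real.exp_pos v).le, Real.log_exp]
    have h0 : ∑ k ∈ Finset.Icc 0 ⌊Real.exp v⌋₊, ArithmeticFunction.vonMangoldt k =
        ∑ k ∈ Finset.Icc 1 ⌊Real.exp v⌋₊, ArithmeticFunction.vonMangoldt k := by
      symm
      apply Finset.sum_subset
      · intro x; simp
      · intro x hx hx'
        have : x = 0 := by
          simp at hx hx'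
          by_contra h
          have := hx' (Nat.pos_of_ne_zero h)
          omega
        simp [this]
    rw [h0]
    push_cast
    rw [mul_left_comm, mul_assoc]
    congr 1
    rw [← Complex.exp_add, ← Complex.exp_add]
    congr 1
    ring
  · simp only [Real.rpow_one]
    refine Asymptotics.IsBigO.of_bound (Real.log 4 + 4) (Eventually.of_forall fun n => ?_)
    have h1 := Chebyshev.psi_le_const_mul_self (Nat.cast_nonneg (α := ℝ) n)
    have h0 := Chebyshev.psi_nonneg n
    rw [Chebyshev.psi] at h1 h0
    rw [Nat.floor_natCast] at h1 h0
    have : Finset.Icc 1 n = Finset.Ioc 0 n := by ext; simp [Nat.succ_le_iff]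
    rw [this]
    simp only [Real.norm_eq_abs, Nat.abs_cast]
    rwa [abs_of_nonneg h0]

lemma exists_g : ∃ g : ℂ → ℂ, ContinuousOn g {z | 0 ≤ z.re} ∧
    ∀ z : ℂ, 0 < z.re → ∫ v in Ioi (0:ℝ), (aa v : ℂ) * Complex.exp (-z * v) = g z := by
  obtain ⟨G, hG, hGL⟩ := exists_G
  refine ⟨fun z => (G (1 + z) - 1) / (1 + z), ?_, ?_⟩
  · apply ContinuousOn.div
    · refine (hG.comp (by fun_prop) ?_).sub continuousOn_const
      intro z hz
      simpa using hz
    · fun_prop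
    · intro z hz h
      have := congrArg Complex.re h
      simp at this hz
      linarith
  · intro z hz
    have h1 := hGL (1 + z) (by simpa using hz)
    rw [psi_mellin (by simpa using hz)] at h1
    have hz0 : z ≠ 0 := by rintro rfl; simp at hz
    have hz1 : 1 + z ≠ 0 := by
      intro h
      have := congrArg Complex.re h
      simp at this
      linarith
    have hi := integrableOn_exp_mul_complex_Ioi (a := -z) (by simpa using hz) 0
    have h2 : ∫ v in Ioi (0:ℝ), ((Chebyshev.psi (Real.exp v) * Real.exp (-v) : ℝ) : ℂ)
        * Complex.exp (-(1 + z - 1) * v) =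
        (∫ v in Ioi (0:ℝ), (aa v : ℂ) * Complex.exp (-z * v)) + 1 / z := by
      have h3 := integral_exp_mul_complex_Ioi (a := -z) (by simpa using hz) 0
      have h4 : (1:ℂ) / z = -Complex.exp (-z * (0:ℝ)) / (-z) := by simp
      rw [h4, ← h3, ← integral_add (aa_integrable hz) hi]
      refine setIntegral_congr_fun measurableSet_Ioi fun v _ => ?_
      simp only [aa]
      push_cast
      rw [add_sub_cancel_left]
      ring
    rw [h2] at h1
    rw [eq_div_iff hz1]
    rw [add_sub_cancel_left] at h1
    field_simp at h1 ⊢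
    have : z * ((∫ v in Ioi (0:ℝ), (aa v : ℂ) * Complex.exp (-z * v)) * (1 + z)) = z * (G (1+z) - 1) := by
      simp only [neg_mul] at h1 ⊢
      linear_combination h1
    have := mul_left_cancel₀ hz0 this
    rw [mul_comm] at this
    simpa [neg_mul] using this


lemma sinc_sq_eq (y : ℝ) : ((Real.sinc (y / 2)) ^ 2 : ℝ) =
    (∫ t in (0:ℝ)..1, (2 * (1 - t) : ℂ) * Complex.exp (Complex.I * (t * y))).re := by
  by_cases hy : y = 0
  · subst hy
    simp
    have : ∫ t in (0:ℝ)..1, (1 - t : ℂ) = ((∫ t in (0:ℝ)..1, (1 - t) : ℝ) : ℂ) := by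
      rw [← intervalIntegral.integral_ofReal]; push_cast; rfl
    rw [this, intervalIntegral.integral_sub (by simp) (by simp)]
    norm_num
  · have hyc : (y : ℂ) ≠ 0 := by exact_mod_cast hy
    have hder : ∀ t ∈ uIcc (0:ℝ) 1, HasDerivAt (fun t : ℝ => (2 * (1 - t) : ℂ) *
        Complex.exp (Complex.I * (t * y)) / (Complex.I * y)
        - 2 * Complex.exp (Complex.I * (t * y)) / (y ^ 2))
        ((2 * (1 - t) : ℂ) * Complex.exp (Complex.I * (t * y))) t := by
      intro t _
      have hid : HasDerivAt (fun t : ℝ => (t : ℂ)) 1 t := Complex.ofRealCLM.hasDerivAt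
      have h1 : HasDerivAt (fun t : ℝ => Complex.exp (Complex.I * (t * y)))
          (Complex.exp (Complex.I * (t * y)) * (Complex.I * (1 * y))) t :=
        ((hid.mul_const (y : ℂ)).const_mul Complex.I).cexp
      have h2 : HasDerivAt (fun t : ℝ => (2 * (1 - t) : ℂ)) (2 * (0 - 1)) t :=
        ((hasDerivAt_const t (1:ℂ)).sub hid).const_mul 2
      have h3 := ((h2.mul h1).div_const (Complex.I * y)).sub ((h1.const_mul 2).div_const ((y:ℂ) ^ 2))
      refine HasDerivAt.congr_deriv h3 ?_
      have := Complex.I_ne_zero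
      field_simp
      ring_nf
      simp only [Complex.I_sq]
      ring
    rw [intervalIntegral.integral_eq_sub_of_hasDerivAt hder
      (by apply Continuous.intervalIntegrable; fun_prop)]
    have h4 : (Complex.exp (Complex.I * ((1:ℝ) * y))) = (Real.cos y : ℂ) + (Real.sin y : ℂ) * Complex.I := by
      rw [mul_comm]; simp [Complex.exp_mul_I]
    rw [h4, Real.sinc_of_ne_zero (by simpa using hy)]
    have h5 : Real.cos y = 1 - 2 * Real.sin (y / 2) ^ 2 := by
      have := Real.cos_two_mul' (y / 2)
      rw [mul_div_cancel₀ _ two_ne_zero] at this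
      have := Real.sin_sq_add_cos_sq (y / 2)
      linarith
    have h6 : ∀ w : ℂ, (w / (y:ℂ)^2).re = w.re / y ^ 2 := by
      intro w
      rw [← Complex.ofReal_pow, Complex.div_ofReal_re]
    have h7 : ((2:ℂ) / (Complex.I * y)).re = 0 := by
      rw [← div_div, Complex.div_ofReal_re]; simp
    rw [Complex.sub_re, Complex.sub_re, Complex.sub_re, h6, h6]
    simp [h7]
    rw [← Complex.ofReal_cos, Complex.ofReal_re, h5]
    field_simp
    ring

lemma sinc_sq_le (y : ℝ) : (Real.sinc (y / 2)) ^ 2 ≤ 8 * (1 + y ^ 2)⁻¹ := by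
  have h1 : (Real.sinc (y / 2)) ^ 2 ≤ 1 := by
    rw [sq_le_one_iff_abs_le_one]; exact Real.abs_sinc_le_one _
  rw [← div_eq_mul_inv, le_div_iff₀ (by positivity)]
  by_cases hy : y = 0
  · subst hy; simp
  · have h2 : (Real.sinc (y / 2)) ^ 2 * y ^ 2 = 4 * Real.sin (y / 2) ^ 2 := by
      rw [Real.sinc_of_ne_zero (by simpa using hy)]
      field_simp
      ring
    have := Real.sin_sq_le_one (y / 2)
    nlinarith

lemma sinc_sq_integrable : Integrable (fun y : ℝ => (Real.sinc (y / 2)) ^ 2) := by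
  refine (integrable_inv_one_add_sq.const_mul 8).mono' ?_ ?_
  · exact (by fun_prop : Continuous fun y : ℝ => (Real.sinc (y / 2)) ^ 2).aestronglyMeasurable
  · refine Eventually.of_forall fun y => ?_
    rw [Real.norm_of_nonneg (sq_nonneg _)]
    exact sinc_sq_le y

lemma sinc_sq_integrable' {lam : ℝ} (hl : 0 < lam) (u : ℝ) :
    Integrable (fun v : ℝ => (Real.sinc (lam * (v - u) / 2)) ^ 2) := by
  have := (sinc_sq_integrable.comp_mul_left' hl.ne').comp_sub_right u
  exact this

lemma fubini {g : ℂ → ℂ}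
    (hg : ∀ z : ℂ, 0 < z.re → ∫ v in Ioi (0:ℝ), (aa v : ℂ) * Complex.exp (-z * v) = g z)
    (lam u : ℝ) {ε : ℝ} (hε : 0 < ε) :
    ∫ v in Ioi (0:ℝ), aa v * Real.exp (-ε * v) * (Real.sinc (lam * (v - u) / 2)) ^ 2 =
    (∫ t in (0:ℝ)..1, (2 * (1 - t) : ℂ) * Complex.exp (-Complex.I * (t * (lam * u))) *
      g (ε - Complex.I * (lam * t))).re := by
  have hintg : Integrable (Function.uncurry fun (v t : ℝ) =>
      ((aa v : ℂ) * Complex.exp (-ε * v)) * ((2 * (1 - t) : ℂ) *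
        Complex.exp (Complex.I * (t * (lam * (v - u))))))
      ((volume.restrict (Ioi 0)).prod (volume.restrict (Ioc 0 1))) := by
    have h1 : Integrable (fun v : ℝ => (aa v : ℂ) * Complex.exp (-ε * v))
        (volume.restrict (Ioi 0)) := aa_integrable (z := ε) (by simpa using hε)
    have h2 : Integrable (fun t : ℝ => (2 * (1 - t) : ℂ)) (volume.restrict (Ioc 0 1)) := by
      have : IntegrableOn (fun t : ℝ => (2 * (1 - t) : ℂ)) (Icc 0 1) :=
        (by fun_prop : Continuous fun t : ℝ => (2 * (1 - t) : ℂ)).continuousOn.integrableOn_compact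
          isCompact_Icc
      exact this.mono_set Ioc_subset_Icc_self
    have h3 := h1.mul_prod h2
    have h4 := Integrable.bdd_mul (c := 1) h3
      (f := fun p : ℝ × ℝ => Complex.exp (Complex.I * (p.2 * (lam * (p.1 - u))))) ?_ ?_
    · refine h4.congr (Eventually.of_forall fun p => ?_)
      simp only [Function.uncurry]
      ring
    · exact (by fun_prop : Continuous fun p : ℝ × ℝ =>
        Complex.exp (Complex.I * (p.2 * (lam * (p.1 - u))))).aestronglyMeasurable
    · refine Eventually.of_forall fun p => ?_
      rw [Complex.norm_exp]
      simp
  have hswap := integral_integral_swap hintg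
  have hL : ∫ v in Ioi (0:ℝ), aa v * Real.exp (-ε * v) * (Real.sinc (lam * (v - u) / 2)) ^ 2 =
      (∫ v in Ioi (0:ℝ), ∫ t in Ioc (0:ℝ) 1, ((aa v : ℂ) * Complex.exp (-ε * v)) * ((2 * (1 - t) : ℂ) *
        Complex.exp (Complex.I * (t * (lam * (v - u)))))).re := by
    have := integral_re (𝕜 := ℂ) hintg.integral_prod_left
    simp only [Function.uncurry] at this
    refine Eq.trans ?_ this
    refine setIntegral_congr_fun measurableSet_Ioi fun v _ => ?_
    rw [integral_const_mul, sinc_sq_eq, intervalIntegral.integral_of_le zero_le_one]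
    have hr : ((aa v : ℂ) * Complex.exp (-ε * v)) = ((aa v * Real.exp (-ε * v) : ℝ) : ℂ) := by
      push_cast; rfl
    rw [hr]
    simp only [RCLike.re_to_complex]
    rw [Complex.re_ofReal_mul]
    push_cast
    rfl
  rw [hL, hswap, intervalIntegral.integral_of_le zero_le_one]
  congr 1
  refine setIntegral_congr_fun measurableSet_Ioc fun t _ => ?_
  rw [← hg _ (by simpa using hε), ← integral_const_mul]
  refine setIntegral_congr_fun measurableSet_Ioi fun v _ => ?_
  have : Complex.exp (-(ε - Complex.I * (lam * t)) * v) * Complex.exp (-Complex.I * (t * (lam * u)))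
    = Complex.exp (-ε * v) * Complex.exp (Complex.I * (t * (lam * (v - u)))) := by
    rw [← Complex.exp_add, ← Complex.exp_add]
    congr 1
    ring
  linear_combination (-(aa v : ℂ) * (2 * (1 - t))) * this


lemma core_eq {g : ℂ → ℂ} (hgc : ContinuousOn g {z | 0 ≤ z.re})
    (hg : ∀ z : ℂ, 0 < z.re → ∫ v in Ioi (0:ℝ), (aa v : ℂ) * Complex.exp (-z * v) = g z)
    {lam : ℝ} (hl : 0 < lam) (u : ℝ) :
    ∫ v in Ioi (0:ℝ), aa v * (Real.sinc (lam * (v - u) / 2)) ^ 2 =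
    (∫ t in (0:ℝ)..1, (2 * (1 - t) : ℂ) * Complex.exp (-Complex.I * (t * (lam * u))) *
      g (- Complex.I * (lam * t))).re := by
  have h1 : Tendsto (fun ε : ℝ => ∫ v in Ioi (0:ℝ), aa v * Real.exp (-ε * v) *
      (Real.sinc (lam * (v - u) / 2)) ^ 2) (𝓝[>] 0)
      (𝓝 (∫ v in Ioi (0:ℝ), aa v * (Real.sinc (lam * (v - u) / 2)) ^ 2)) := by
    refine tendsto_integral_filter_of_dominated_convergence
      (fun v => 10 * (Real.sinc (lam * (v - u) / 2)) ^ 2) ?_ ?_ ?_ ?_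
    · refine Eventually.of_forall fun ε => ?_
      have := aa_meas
      refine Measurable.aestronglyMeasurable ?_
      refine (this.mul (by fun_prop)).mul ?_
      exact (by fun_prop : Continuous fun v : ℝ => (Real.sinc (lam * (v - u) / 2)) ^ 2).measurable
    · filter_upwards [self_mem_nhdsWithin] with ε hε
      filter_upwards [ae_restrict_mem measurableSet_Ioi] with v hv
      rw [Real.norm_eq_abs, abs_mul, abs_mul, abs_of_nonneg (sq_nonneg (Real.sinc _))]
      gcongr
      have h2 : |Real.exp (-ε * v)| ≤ 1 := by
        rw [abs_of_pos (Real.exp_pos _), Real.exp_le_one_iff]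
        have : 0 < ε * v := mul_pos hε hv
        linarith
      have := aa_bound v
      calc |aa v| * |Real.exp (-ε * v)| ≤ 10 * 1 := by gcongr
        _ = 10 := by norm_num
    · exact ((sinc_sq_integrable' hl u).const_mul 10).integrableOn
    · refine Eventually.of_forall fun v => ?_
      have : Continuous fun ε : ℝ => aa v * Real.exp (-ε * v) *
        (Real.sinc (lam * (v - u) / 2)) ^ 2 := by fun_prop
      have := this.tendsto 0
      simp only [neg_zero, zero_mul, Real.exp_zero, mul_one] at this
      exact this.mono_left nhdsWithin_le_nhds
  have hcont : ContinuousOn (fun p : ℝ × ℝ => g (p.1 - Complex.I * (lam * p.2)))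
      (Ici 0 ×ˢ univ) := by
    refine hgc.comp (by fun_prop) ?_
    rintro ⟨a, b⟩ ⟨ha, -⟩
    simpa using ha
  obtain ⟨M, hM⟩ := ((isCompact_Icc (a := (0:ℝ)) (b := 1)).prod
    (isCompact_Icc (a := (0:ℝ)) (b := 1))).exists_bound_of_continuousOn
    (hcont.mono (prod_mono Icc_subset_Ici_self (subset_univ _)))
  have hct : ∀ ε : ℝ, 0 ≤ ε → Continuous fun t : ℝ => g (ε - Complex.I * (lam * t)) := by
    intro ε hε
    have := hcont.comp_continuous (f := fun t : ℝ => (ε, t)) (by fun_prop)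
      (fun t => ⟨hε, mem_univ _⟩)
    exact this
  have h2 : Tendsto (fun ε : ℝ => ∫ t in (0:ℝ)..1, (2 * (1 - t) : ℂ) *
      Complex.exp (-Complex.I * (t * (lam * u))) * g (ε - Complex.I * (lam * t))) (𝓝[>] 0)
      (𝓝 (∫ t in (0:ℝ)..1, (2 * (1 - t) : ℂ) * Complex.exp (-Complex.I * (t * (lam * u))) *
      g (- Complex.I * (lam * t)))) := by
    refine intervalIntegral.tendsto_integral_filter_of_dominated_convergence
      (fun t => 2 * M) ?_ ?_ ?_ ?_
    · filter_upwards [self_mem_nhdsWithin] with ε hε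
      have := hct ε (le_of_lt hε)
      exact ((by fun_prop : Continuous fun t : ℝ => (2 * (1 - t) : ℂ) *
        Complex.exp (-Complex.I * (t * (lam * u)))).mul this).aestronglyMeasurable
    · have : ∀ᶠ ε : ℝ in 𝓝[>] 0, ε ∈ Ioc (0:ℝ) 1 := Ioc_mem_nhdsGT zero_lt_one
      filter_upwards [this] with ε hε
      refine Eventually.of_forall fun t ht => ?_
      rw [uIoc_of_le zero_le_one] at ht
      rw [norm_mul, norm_mul]
      have e1 : ‖Complex.exp (-Complex.I * (t * (lam * u)))‖ = 1 := by
        rw [Complex.norm_exp]; simp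
      have e2 : ‖(2 * (1 - t) : ℂ)‖ ≤ 2 := by
        have : (2 * (1 - t) : ℂ) = ((2 * (1 - t) : ℝ) : ℂ) := by push_cast; rfl
        rw [this, Complex.norm_real, Real.norm_eq_abs, abs_le]
        constructor <;> linarith [ht.1, ht.2]
      have e3 := hM (ε, t) ⟨⟨hε.1.le, hε.2⟩, ⟨ht.1.le, ht.2⟩⟩
      rw [e1, mul_one]
      simp only at e3
      gcongr
    · simp
    · refine Eventually.of_forall fun t ht => ?_
      refine Tendsto.const_mul _ ?_
      have := hcont (0, t) ⟨le_refl (0:ℝ), mem_univ _⟩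
      have h3 : Tendsto (fun ε : ℝ => (ε, t)) (𝓝[>] 0) (𝓝[Ici 0 ×ˢ univ] (0, t)) := by
        rw [tendsto_nhdsWithin_iff]
        refine ⟨(by fun_prop : Continuous fun ε : ℝ => (ε, t)).tendsto' 0 _ rfl
          |>.mono_left nhdsWithin_le_nhds, ?_⟩
        filter_upwards [self_mem_nhdsWithin] with ε hε
        exact ⟨(le_of_lt hε : (0:ℝ) ≤ ε), mem_univ _⟩
      have h4 := this.tendsto.comp h3
      simpa [Function.comp_def] using h4
  have h3 := (Complex.continuous_re.tendsto _).comp h2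
  refine tendsto_nhds_unique h1 (h3.congr' ?_)
  filter_upwards [self_mem_nhdsWithin] with ε hε
  exact (fubini hg lam u hε).symm

lemma core_tendsto {lam : ℝ} (hl : 0 < lam) :
    Tendsto (fun u : ℝ => ∫ v in Ioi (0:ℝ), aa v * (Real.sinc (lam * (v - u) / 2)) ^ 2)
      atTop (𝓝 0) := by
  obtain ⟨g, hgc, hg⟩ := exists_g
  simp_rw [core_eq hgc hg hl]
  have h := Real.tendsto_integral_exp_smul_cocompact
    (fun t : ℝ => (Ioc (0:ℝ) 1).indicator (fun t : ℝ => (2 * (1 - t) : ℂ) *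
      g (- Complex.I * (lam * t))) t)
  have h1 : Tendsto (fun u : ℝ => lam * u / (2 * Real.pi)) atTop (cocompact ℝ) := by
    refine Tendsto.mono_right ?_ atTop_le_cocompact
    exact (tendsto_id.const_mul_atTop hl).atTop_div_const (by positivity)
  have h2 := (Complex.continuous_re.tendsto _).comp (h.comp h1)
  rw [Complex.zero_re] at h2
  refine h2.congr fun u => ?_
  simp only [Function.comp_def]
  congr 1
  rw [intervalIntegral.integral_of_le zero_le_one, ← integral_indicator measurableSet_Ioc]
  congr 1
  funext t
  by_cases ht : t ∈ Ioc (0:ℝ) 1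
  · simp only [indicator_of_mem ht, Circle.smul_def, Real.fourierChar_apply, smul_eq_mul]
    have : ((2 * Real.pi * -(t * (lam * u / (2 * Real.pi))) : ℝ) : ℂ) * Complex.I =
        -Complex.I * (t * (lam * u)) := by
      have : (2 * Real.pi * -(t * (lam * u / (2 * Real.pi))) : ℝ) = -(t * (lam * u)) := by
        field_simp
      rw [this]; push_cast; ring
    rw [this]
    ring
  · simp only [indicator_of_notMem ht, smul_zero]


lemma sinc_sq_integral_pos : 0 < ∫ y : ℝ, (Real.sinc (y / 2)) ^ 2 := by
  rw [integral_pos_iff_support_of_nonneg (fun y => sq_nonneg _) sinc_sq_integrable]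
  have hc : Continuous fun y : ℝ => (Real.sinc (y / 2)) ^ 2 := by fun_prop
  exact hc.isOpen_support.measure_pos volume ⟨0, by simp⟩

lemma tail_tendsto : Tendsto (fun R : ℝ => ∫ y : ℝ,
    {y : ℝ | R < |y|}.indicator (fun y => (Real.sinc (y / 2)) ^ 2) y) atTop (𝓝 0) := by
  rw [← integral_zero ℝ ℝ]
  have hc : Continuous fun y : ℝ => (Real.sinc (y / 2)) ^ 2 := by fun_prop
  refine tendsto_integral_filter_of_dominated_convergence
    (fun y => (Real.sinc (y / 2)) ^ 2) ?_ ?_ sinc_sq_integrable ?_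
  · refine Eventually.of_forall fun R => ?_
    exact (hc.measurable.indicator
      (measurableSet_lt measurable_const (by fun_prop))).aestronglyMeasurable
  · refine Eventually.of_forall fun R => Eventually.of_forall fun y => ?_
    refine (norm_indicator_le_norm_self _ _).trans ?_
    rw [Real.norm_of_nonneg (sq_nonneg _)]
  · refine Eventually.of_forall fun y => ?_
    refine tendsto_const_nhds.congr' ?_
    filter_upwards [eventually_ge_atTop |y|] with R hR
    rw [indicator_of_notMem]
    simpa using hR

lemma tauber {b : ℝ → ℝ} (hbm : Measurable b) (hb : ∀ v, |b v| ≤ 10)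
    (h : ∀ lam : ℝ, 0 < lam → Tendsto (fun u : ℝ => ∫ v in Ioi (0:ℝ), b v *
      (Real.sinc (lam * (v - u) / 2)) ^ 2) atTop (𝓝 0)) {η w : ℝ} (hη : 0 < η) (hw : 0 < w) :
    ∀ᶠ u in atTop, ∃ v ∈ Icc (u - w) (u + w), b v < η := by
  set F : ℝ → ℝ := fun y => (Real.sinc (y / 2)) ^ 2 with hF
  have hF0 : ∀ y, 0 ≤ F y := fun y => sq_nonneg _
  set c := ∫ y : ℝ, F y with hc
  have hcpos : 0 < c := sinc_sq_integral_pos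
  have hev := (tail_tendsto.eventually_lt_const
    (show 0 < η * c / 2 / (η + 10) by positivity)).and (eventually_gt_atTop 0)
  obtain ⟨R, hR, hR0⟩ := hev.exists
  set lam := R / w with hlam
  have hl : 0 < lam := by positivity
  have hev2 := (h lam hl).eventually_lt_const (show 0 < lam⁻¹ * (η * c / 2) by positivity)
  filter_upwards [hev2, eventually_gt_atTop w] with u hu huw
  by_contra! hcon
  set H : ℝ → ℝ := fun y => η * F y - (η + 10) * {y : ℝ | R < |y|}.indicator F y with hH
  have hFi : Integrable F := sinc_sq_integrable
  have hmeas : MeasurableSet {y : ℝ | R < |y|} := measurableSet_lt measurable_const (by fun_prop)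
  have hHi : Integrable H := (hFi.const_mul η).sub ((hFi.indicator hmeas).const_mul _)
  have hHint : η * c / 2 < ∫ y, H y := by
    rw [hH, integral_sub (hFi.const_mul η) ((hFi.indicator hmeas).const_mul _),
      integral_const_mul, integral_const_mul]
    rw [lt_div_iff₀ (by positivity)] at hR
    simp only [← hc]
    linarith
  have hH2 : ∫ v, H (lam * (v - u)) = lam⁻¹ * ∫ y, H y := by
    rw [integral_sub_right_eq_self (fun v => H (lam * v)) u, Measure.integral_comp_mul_left,
      abs_of_pos (by positivity), smul_eq_mul]
  have hle : ∫ v, H (lam * (v - u)) ≤ ∫ v in Ioi (0:ℝ), b v * F (lam * (v - u)) := by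
    rw [← integral_indicator measurableSet_Ioi]
    refine integral_mono ?_ ?_ ?_
    · exact (hHi.comp_mul_left' hl.ne').comp_sub_right u
    · refine Integrable.indicator ?_ measurableSet_Ioi
      refine Integrable.bdd_mul (c := 10) (sinc_sq_integrable' hl u) hbm.aestronglyMeasurable ?_
      exact Eventually.of_forall hb
    · intro v
      simp only [hH]
      have hFv := hF0 (lam * (v - u))
      by_cases hv : R < |lam * (v - u)|
      · rw [indicator_of_mem (by exact hv)]
        by_cases hv0 : v ∈ Ioi (0:ℝ)
        · rw [indicator_of_mem hv0]
          have := (abs_le.1 (hb v)).1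
          nlinarith
        · rw [indicator_of_notMem hv0]
          nlinarith
      · rw [indicator_of_notMem (by exact hv)]
        rw [not_lt, abs_mul, abs_of_pos hl, hlam, div_mul_eq_mul_div, div_le_iff₀ hw,
          mul_le_mul_iff_right₀ hR0, abs_le] at hv
        have hv0 : v ∈ Ioi (0:ℝ) := by
          rw [mem_Ioi]; linarith [hv.1]
        rw [indicator_of_mem hv0]
        have := hcon v ⟨by linarith [hv.1], by linarith [hv.2]⟩
        nlinarith
  have h9 : lam⁻¹ * (η * c / 2) < lam⁻¹ * ∫ y, H y := by gcongr
  have : ∫ v in Ioi (0:ℝ), b v * F (lam * (v - u)) < lam⁻¹ * (η * c / 2) := hu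
  linarith

lemma aa_tendsto : Tendsto aa atTop (𝓝 0) := by
  have hPhi : ∀ v₁ v₂, v₁ ≤ v₂ → (aa v₁ + 1) * Real.exp (v₁ - v₂) ≤ aa v₂ + 1 := by
    intro v₁ v₂ h
    unfold aa
    have := Chebyshev.psi_mono (Real.exp_le_exp.2 h)
    rw [sub_add_cancel, sub_add_cancel, mul_assoc, ← Real.exp_add]
    rw [show -v₁ + (v₁ - v₂) = -v₂ by ring]
    gcongr
  rw [Metric.tendsto_nhds]
  intro δ' hδ'
  set δ := min δ' (1/2) with hδdef
  have hδ : 0 < δ := by positivity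
  have hδ1 : δ ≤ 1/2 := min_le_right _ _
  set w := δ / 8 with hw
  have hwpos : 0 < w := by positivity
  have t1 := tauber aa_meas aa_bound (fun lam hl => core_tendsto hl) (η := δ / 2)
    (by positivity) hwpos
  have t2 := tauber (b := fun v => - aa v) aa_meas.neg (fun v => by simpa using aa_bound v)
    (fun lam hl => by
      have := (core_tendsto hl).neg
      simpa [integral_neg] using this) (η := δ / 2) (by positivity) hwpos
  have t1' := (tendsto_atTop_add_const_right atTop w tendsto_id).eventually t1
  have t2' := (tendsto_atTop_add_const_right atTop (-w) tendsto_id).eventually t2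
  filter_upwards [t1', t2'] with u h1 h2
  obtain ⟨v, ⟨hv1, hv2⟩, hv⟩ := h1
  obtain ⟨v', ⟨hv1', hv2'⟩, hv'⟩ := h2
  simp only [id] at hv1 hv2 hv1' hv2'
  have e1 := hPhi u v (by linarith)
  have e2 := hPhi v' u (by linarith)
  have b1 : 1 - 2 * w ≤ Real.exp (u - v) := by
    have := Real.add_one_le_exp (u - v); linarith
  have b2 : 1 - 2 * w ≤ Real.exp (v' - u) := by
    have := Real.add_one_le_exp (v' - u); linarith
  have p1 : 0 ≤ aa u + 1 := by
    unfold aa; rw [sub_add_cancel]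
    exact mul_nonneg (Chebyshev.psi_nonneg _) (Real.exp_pos _).le
  rw [dist_zero_right, Real.norm_eq_abs, abs_lt]
  have hmin : δ ≤ δ' := min_le_left _ _
  have q1 : (aa u + 1) * (1 - 2 * w) ≤ aa v + 1 := le_trans (by gcongr) e1
  have q2 : (1 - δ/2) * (1 - 2 * w) ≤ aa u + 1 := by
    have : (1 - δ/2) * (1 - 2 * w) ≤ (aa v' + 1) * Real.exp (v' - u) :=
      mul_le_mul (by linarith) b2 (by linarith) (by linarith)
    linarith
  constructor
  · nlinarith
  · by_contra! hc
    have : (1 + δ) * (1 - 2 * w) ≤ (aa u + 1) * (1 - 2 * w) := by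
      apply mul_le_mul_of_nonneg_right <;> linarith
    nlinarith

lemma psi_pnt : Tendsto (fun x : ℝ => Chebyshev.psi x / x) atTop (𝓝 1) := by
  have h := (aa_tendsto.comp Real.tendsto_log_atTop).add_const 1
  rw [zero_add] at h
  refine h.congr' ?_
  filter_upwards [eventually_gt_atTop 0] with x hx
  simp [aa, Real.exp_neg, Real.exp_log hx, div_eq_mul_inv]

lemma theta_pnt : Tendsto (fun x : ℝ => Chebyshev.theta x / x) atTop (𝓝 1) := by
  have h1 : (Chebyshev.psi - Chebyshev.theta) =o[atTop] (fun x : ℝ => x) := by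
    refine Chebyshev.isBigO_psi_sub_theta_sqrt.trans_isLittleO ?_
    refine Asymptotics.isLittleO_of_tendsto' ?_ ?_
    · filter_upwards [eventually_gt_atTop 0] with x hx h0
      exact absurd h0 hx.ne'
    · have := Real.tendsto_sqrt_atTop.inv_tendsto_atTop
      refine this.congr fun x => ?_
      simp [Real.sqrt_div_self]
  have h2 := psi_pnt.sub h1.tendsto_div_nhds_zero
  rw [sub_zero] at h2
  refine h2.congr fun x => ?_
  simp only [Pi.sub_apply]
  ring

end LandauPNT

namespace LandauPNT
open MeasureTheory Filter Topology Set

/-- summatory function -/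
noncomputable def S (f : ArithmeticFunction ℝ) (x : ℝ) : ℝ := ∑ n ∈ Finset.Ioc 0 ⌊x⌋₊, f n

/-- indicator function of the primes -/
noncomputable def P : ArithmeticFunction ℝ :=
  ⟨fun n => if n.Prime then 1 else 0, by simp [Nat.not_prime_zero]⟩

/-- reciprocals of the primes -/
noncomputable def P' : ArithmeticFunction ℝ :=
  ⟨fun n => if n.Prime then (n : ℝ)⁻¹ else 0, by simp⟩

lemma P_apply (n : ℕ) : P n = if n.Prime then 1 else 0 := rfl
lemma P'_apply (n : ℕ) : P' n = if n.Prime then (n : ℝ)⁻¹ else 0 := rfl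

lemma mertens_formula {x : ℝ} (hx : 2 ≤ x) : S P' x = (x * Real.log x)⁻¹ * Chebyshev.theta x +
    ∫ t in (2:ℝ)..x, ((Real.log t + 1) / (t * Real.log t) ^ 2) * Chebyshev.theta t := by
  let a : ℕ → ℝ := fun n => if n.Prime then Real.log n else 0
  have hth : ∀ t : ℝ, ∑ k ∈ Finset.Icc 0 ⌊t⌋₊, a k = Chebyshev.theta t := by
    intro t
    rw [Chebyshev.theta_eq_sum_Icc, Finset.sum_filter]
  have hder : ∀ t : ℝ, 2 ≤ t → HasDerivAt (fun t : ℝ => (t * Real.log t)⁻¹)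
      (-((Real.log t + 1) / (t * Real.log t) ^ 2)) t := by
    intro t ht
    have h0 : t ≠ 0 := by linarith
    have hl : 0 < Real.log t := Real.log_pos (by linarith)
    have h1 := ((hasDerivAt_id t).mul (Real.hasDerivAt_log h0)).inv
      (by simp only [Pi.mul_apply, id]; positivity)
    refine HasDerivAt.congr_deriv h1 ?_
    simp only [Pi.mul_apply, id]
    field_simp
  have hS : S P' x = ∑ n ∈ Finset.Icc 0 ⌊x⌋₊, (n * Real.log n)⁻¹ * a n := by
    unfold S
    refine Finset.sum_subset_zero_on_sdiff ?_ ?_ ?_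
    · intro n; simp
    · intro n hn
      have : n = 0 := by simpa using hn
      simp [this]
    · intro n _
      rw [P'_apply]
      simp only [a]
      split_ifs with h
      · have : Real.log n ≠ 0 := (Real.log_pos (by exact_mod_cast h.one_lt)).ne'
        have : (n:ℝ) ≠ 0 := by exact_mod_cast h.ne_zero
        field_simp
      · simp
  rw [hS, sum_mul_eq_sub_integral_mul₁ a (f := fun t => (t * Real.log t)⁻¹) (by simp [a])
    (by simp [a]), ← intervalIntegral.integral_of_le hx, hth, sub_eq_add_neg,
    ← intervalIntegral.integral_neg]
  · congr 1
    refine intervalIntegral.integral_congr fun t ht => ?_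
    rw [uIcc_of_le hx] at ht
    simp only [hth]
    rw [(hder t ht.1).deriv]
    ring
  · intro t ht
    exact (hder t ht.1).differentiableAt
  · refine ContinuousOn.integrableOn_Icc ?_
    have : ContinuousOn (fun t : ℝ => -((Real.log t + 1) / (t * Real.log t) ^ 2)) (Icc 2 x) := by
      intro t ht
      have h0 : t ≠ 0 := by linarith [ht.1]
      have hl : 0 < Real.log t := Real.log_pos (by linarith [ht.1])
      apply ContinuousAt.continuousWithinAt
      have : (t * Real.log t) ^ 2 ≠ 0 := by positivity
      fun_prop (disch := assumption)
    exact this.congr fun t ht => (hder t ht.1).deriv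

lemma loglog_tendsto : Tendsto (fun x : ℝ => Real.log (Real.log x)) atTop atTop :=
  Real.tendsto_log_atTop.comp Real.tendsto_log_atTop

lemma integral_inv_log {a x : ℝ} (ha : 2 ≤ a) (hx : a ≤ x) :
    ∫ t in a..x, (t * Real.log t)⁻¹ = Real.log (Real.log x) - Real.log (Real.log a) := by
  refine intervalIntegral.integral_eq_sub_of_hasDerivAt (f := fun t => Real.log (Real.log t)) ?_ ?_
  · intro t ht
    rw [uIcc_of_le hx] at ht
    have h0 : t ≠ 0 := by linarith [ht.1]
    have hl : 0 < Real.log t := Real.log_pos (by linarith [ht.1])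
    refine ((Real.hasDerivAt_log h0).log hl.ne').congr_deriv ?_
    field_simp
  · refine ContinuousOn.intervalIntegrable ?_
    intro t ht
    rw [uIcc_of_le hx] at ht
    have h0 : t ≠ 0 := by linarith [ht.1]
    have hl : 0 < Real.log t := Real.log_pos (by linarith [ht.1])
    apply ContinuousAt.continuousWithinAt
    have : (t * Real.log t) ≠ 0 := by positivity
    fun_prop (disch := assumption)

lemma mertens : Tendsto (fun x : ℝ => S P' x / Real.log (Real.log x)) atTop (𝓝 1) := by
  set h : ℝ → ℝ := fun t => (t * Real.log t)⁻¹ with hh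
  set r : ℝ → ℝ := fun t => ((Real.log t + 1) / (t * Real.log t) ^ 2) * Chebyshev.theta t with hr
  have hhi : ∀ a b : ℝ, 2 ≤ a → a ≤ b → IntervalIntegrable h volume a b := by
    intro a b ha hab
    refine ContinuousOn.intervalIntegrable ?_
    intro t ht
    rw [uIcc_of_le hab] at ht
    have h0 : t ≠ 0 := by linarith [ht.1]
    have hl : 0 < Real.log t := Real.log_pos (by linarith [ht.1])
    apply ContinuousAt.continuousWithinAt
    have : (t * Real.log t) ≠ 0 := by positivity
    fun_prop (disch := assumption)
  have hri : ∀ a b : ℝ, 2 ≤ a → a ≤ b → IntervalIntegrable r volume a b := by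
    intro a b ha hab
    refine (Chebyshev.theta_mono.intervalIntegrable (μ := volume)).continuousOn_mul ?_
    intro t ht
    rw [uIcc_of_le hab] at ht
    have h0 : t ≠ 0 := by linarith [ht.1]
    have hl : 0 < Real.log t := Real.log_pos (by linarith [ht.1])
    apply ContinuousAt.continuousWithinAt
    have : (t * Real.log t) ^ 2 ≠ 0 := by positivity
    fun_prop (disch := assumption)
  have hratio : Tendsto (fun t : ℝ => (1 + (Real.log t)⁻¹) * (Chebyshev.theta t / t)) atTop (𝓝 1) := by
    have h1 := (Real.tendsto_log_atTop.inv_tendsto_atTop.const_add 1).mul theta_pnt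
    simpa using h1
  have hfirst : Tendsto (fun x : ℝ => (x * Real.log x)⁻¹ * Chebyshev.theta x) atTop (𝓝 0) := by
    have h1 := Real.tendsto_log_atTop.inv_tendsto_atTop.mul theta_pnt
    rw [zero_mul] at h1
    refine h1.congr fun x => ?_
    simp only [Pi.inv_apply]
    rw [mul_inv]; ring
  rw [Metric.tendsto_nhds]
  intro ε hε
  have hev : ∀ᶠ t : ℝ in atTop, |(1 + (Real.log t)⁻¹) * (Chebyshev.theta t / t) - 1| < ε / 2 := by
    have := (Metric.tendsto_nhds.1 hratio) (ε / 2) (by positivity)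
    simpa [Real.dist_eq] using this
  obtain ⟨T, hT2, hT⟩ := ((eventually_ge_atTop (2:ℝ)).and (eventually_forall_ge_atTop.2 hev)).exists
  set K : ℝ := |∫ t in (2:ℝ)..T, r t| + |Real.log (Real.log T)| * (1 + ε/2) + 1 with hK
  have e1 : ∀ᶠ x : ℝ in atTop, |(x * Real.log x)⁻¹ * Chebyshev.theta x| < 1 := by
    have := (Metric.tendsto_nhds.1 hfirst) 1 (by positivity)
    simpa [Real.dist_eq] using this
  filter_upwards [e1, eventually_ge_atTop T, loglog_tendsto.eventually_gt_atTop (2 * K / ε),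
    loglog_tendsto.eventually_gt_atTop 0] with x hx1 hxT hxK hx0
  rw [Real.dist_eq, div_sub_one hx0.ne', abs_div, abs_of_pos hx0, div_lt_iff₀ hx0,
    mertens_formula (hT2.trans hxT)]
  change |(x * Real.log x)⁻¹ * Chebyshev.theta x + (∫ t in (2:ℝ)..x, r t) -
    Real.log (Real.log x)| < _
  rw [← intervalIntegral.integral_add_adjacent_intervals (hri 2 T le_rfl hT2) (hri T x hT2 hxT)]
  have key : |(∫ t in T..x, r t) - ∫ t in T..x, h t| ≤ ε / 2 * ∫ t in T..x, h t := by
    rw [← intervalIntegral.integral_sub (hri T x hT2 hxT) (hhi T x hT2 hxT),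
      ← intervalIntegral.integral_const_mul, ← Real.norm_eq_abs]
    refine intervalIntegral.norm_integral_le_of_norm_le hxT ?_ ((hhi T x hT2 hxT).const_mul _)
    refine Eventually.of_forall fun t ht => ?_
    have h0 : 0 < t := by linarith [ht.1]
    have hl : 0 < Real.log t := Real.log_pos (by linarith [ht.1])
    have : r t - h t = ((1 + (Real.log t)⁻¹) * (Chebyshev.theta t / t) - 1) * h t := by
      simp only [hr, hh]
      field_simp
    rw [this, norm_mul, Real.norm_eq_abs, Real.norm_of_nonneg (by simp only [hh]; positivity)]
    have := hT t ht.1.le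
    gcongr
  rw [integral_inv_log hT2 hxT] at key
  rw [div_lt_iff₀ hε] at hxK
  have q1 := abs_le.1 key
  have q2 := abs_le.1 hx1.le
  have q3 := neg_abs_le (∫ t in (2:ℝ)..T, r t)
  have q4 := le_abs_self (∫ t in (2:ℝ)..T, r t)
  have q5 := neg_abs_le (Real.log (Real.log T))
  have q6 := le_abs_self (Real.log (Real.log T))
  have q7 := mul_le_mul_of_nonneg_left q5 hε.le
  have q8 := mul_le_mul_of_nonneg_left q6 hε.le
  rw [abs_lt]
  constructor <;> nlinarith [q1.1, q1.2, q2.1, q2.2]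

lemma S_mul (f g : ArithmeticFunction ℝ) (x : ℝ) :
    S (f * g) x = ∑ d ∈ Finset.Ioc 0 ⌊x⌋₊, f d * S g (x / d) := by
  unfold S
  rw [ArithmeticFunction.sum_Ioc_mul_eq_sum_sum]
  refine Finset.sum_congr rfl fun d _ => ?_
  rw [Nat.floor_div_natCast]

lemma S_mono {f : ArithmeticFunction ℝ} (hf : ∀ n, 0 ≤ f n) : Monotone (S f) := by
  intro x y hxy
  unfold S
  refine Finset.sum_le_sum_of_subset_of_nonneg ?_ (fun n _ _ => hf n)
  exact Finset.Ioc_subset_Ioc_right (Nat.floor_le_floor hxy)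

lemma S_nonneg {f : ArithmeticFunction ℝ} (hf : ∀ n, 0 ≤ f n) (x : ℝ) : 0 ≤ S f x :=
  Finset.sum_nonneg fun n _ => hf n

lemma mul_nonneg' {f g : ArithmeticFunction ℝ} (hf : ∀ n, 0 ≤ f n) (hg : ∀ n, 0 ≤ g n) (n : ℕ) :
    0 ≤ (f * g) n := by
  rw [ArithmeticFunction.mul_apply]
  exact Finset.sum_nonneg fun p _ => mul_nonneg (hf _) (hg _)

lemma pow_nonneg' {f : ArithmeticFunction ℝ} (hf : ∀ n, 0 ≤ f n) (k n : ℕ) : 0 ≤ (f ^ k) n := by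
  induction k generalizing n with
  | zero => rw [pow_zero, ArithmeticFunction.one_apply]; split_ifs <;> norm_num
  | succ k ih => rw [pow_succ]; exact mul_nonneg' ih hf n

lemma P_nonneg (n : ℕ) : 0 ≤ P n := by rw [P_apply]; split_ifs <;> norm_num
lemma P'_nonneg (n : ℕ) : 0 ≤ P' n := by rw [P'_apply]; split_ifs <;> positivity
lemma P_le_one (n : ℕ) : P n ≤ 1 := by rw [P_apply]; split_ifs <;> norm_num

lemma P'_eq (n : ℕ) : P' n = P n / n := by
  rw [P'_apply, P_apply]; split_ifs <;> simp

/-- multiplication by the logarithm -/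
noncomputable def D (f : ArithmeticFunction ℝ) : ArithmeticFunction ℝ :=
  ⟨fun n => f n * Real.log n, by simp⟩

lemma D_apply (f : ArithmeticFunction ℝ) (n : ℕ) : D f n = f n * Real.log n := rfl

lemma D_mul (f g : ArithmeticFunction ℝ) : D (f * g) = D f * g + f * D g := by
  ext n
  rw [ArithmeticFunction.add_apply, D_apply, ArithmeticFunction.mul_apply,
    ArithmeticFunction.mul_apply, ArithmeticFunction.mul_apply, Finset.sum_mul,
    ← Finset.sum_add_distrib]
  refine Finset.sum_congr rfl fun p hp => ?_
  obtain ⟨h1, h2⟩ := Nat.mem_divisorsAntidiagonal.1 hp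
  have ha : (p.1 : ℝ) ≠ 0 := by
    intro h; apply h2; rw [← h1]; simp [Nat.cast_eq_zero.1 h]
  have hb : (p.2 : ℝ) ≠ 0 := by
    intro h; apply h2; rw [← h1]; simp [Nat.cast_eq_zero.1 h]
  rw [D_apply, D_apply, ← h1, Nat.cast_mul, Real.log_mul ha hb]
  ring

lemma D_pow (f : ArithmeticFunction ℝ) (k : ℕ) : D (f ^ (k + 1)) = (k + 1 : ℝ) • (f ^ k * D f) := by
  induction k with
  | zero => simp
  | succ k ih =>
    rw [pow_succ, D_mul, ih, smul_mul_assoc, mul_right_comm, ← pow_succ]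
    push_cast
    simp only [add_smul, one_smul]

lemma D_rec (k : ℕ) : (k + 1 : ℝ) • D (P ^ (k + 2)) = (k + 2 : ℝ) • (P * D (P ^ (k + 1))) := by
  rw [D_pow, D_pow, mul_smul_comm, ← mul_assoc, ← pow_succ', smul_smul, smul_smul]
  congr 1
  push_cast
  ring

/-- Theta functions -/
noncomputable def T (k : ℕ) (x : ℝ) : ℝ := S (D (P ^ k)) x
/-- Sums of reciprocals -/
noncomputable def L (k : ℕ) (x : ℝ) : ℝ := S (P' ^ k) x
/-- Error term -/
noncomputable def E (k : ℕ) (x : ℝ) : ℝ := T (k + 1) x - (k + 1) * x * L k x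

lemma S_smul (c : ℝ) (f : ArithmeticFunction ℝ) (x : ℝ) : S (c • f) x = c * S f x := by
  unfold S
  rw [Finset.mul_sum]
  rfl

lemma T_rec (k : ℕ) (x : ℝ) : (k + 1) * T (k + 2) x =
    (k + 2) * ∑ d ∈ Finset.Ioc 0 ⌊x⌋₊, P d * T (k + 1) (x / d) := by
  unfold T
  rw [← S_mul, ← S_smul, ← S_smul, D_rec]

lemma L_rec (k : ℕ) (x : ℝ) : L (k + 1) x =
    ∑ d ∈ Finset.Ioc 0 ⌊x⌋₊, P' d * L k (x / d) := by
  unfold L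
  rw [← S_mul, pow_succ']

lemma E_rec (k : ℕ) (x : ℝ) : (k + 1) * E (k + 1) x =
    (k + 2) * ∑ d ∈ Finset.Ioc 0 ⌊x⌋₊, P d * E k (x / d) := by
  have h : ∑ d ∈ Finset.Ioc 0 ⌊x⌋₊, P d * E k (x / d) =
      ∑ d ∈ Finset.Ioc 0 ⌊x⌋₊, P d * T (k + 1) (x / d) - (k + 1) * x * L (k + 1) x := by
    rw [L_rec, Finset.mul_sum, ← Finset.sum_sub_distrib]
    refine Finset.sum_congr rfl fun d _ => ?_
    rw [E, P'_eq]
    ring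
  rw [h, mul_sub, ← T_rec, E]
  push_cast
  ring

lemma D_pow_nonneg (k n : ℕ) : 0 ≤ D (P ^ k) n := by
  rw [D_apply]
  exact mul_nonneg (pow_nonneg' P_nonneg k n) (Real.log_natCast_nonneg n)

lemma L_mono (k : ℕ) : Monotone (L k) := S_mono (pow_nonneg' P'_nonneg k)
lemma L_nonneg (k : ℕ) (x : ℝ) : 0 ≤ L k x := S_nonneg (pow_nonneg' P'_nonneg k) x
lemma T_mono (k : ℕ) : Monotone (T k) := S_mono (D_pow_nonneg k)
lemma T_nonneg (k : ℕ) (x : ℝ) : 0 ≤ T k x := S_nonneg (D_pow_nonneg k) x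

lemma L_zero {x : ℝ} (hx : 1 ≤ x) : L 0 x = 1 := by
  unfold L S
  rw [pow_zero, Finset.sum_eq_single 1]
  · simp
  · intro b _ hb; exact ArithmeticFunction.one_apply_ne hb
  · intro h; exfalso; apply h; simpa using hx

lemma T_one (x : ℝ) : T 1 x = Chebyshev.theta x := by
  unfold T S
  rw [Chebyshev.theta, Finset.sum_filter, pow_one]
  refine Finset.sum_congr rfl fun n _ => ?_
  rw [D_apply, P_apply]; split_ifs <;> simp

lemma L_le (k : ℕ) {x : ℝ} (hx : 1 ≤ x) : L k x ≤ (S P' x) ^ k := by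
  induction k generalizing x with
  | zero => rw [L_zero hx, pow_zero]
  | succ k ih =>
    rw [L_rec, pow_succ', S, Finset.sum_mul]
    refine Finset.sum_le_sum fun d hd => ?_
    refine mul_le_mul_of_nonneg_left ?_ (P'_nonneg d)
    refine (L_mono k ?_).trans (ih hx)
    have : (1:ℝ) ≤ d := by exact_mod_cast (Finset.mem_Ioc.1 hd).1
    exact div_le_self (by linarith) this

lemma le_L (k : ℕ) {y : ℝ} (hy : 1 ≤ y) : (S P' y) ^ k ≤ L k (y ^ k) := by
  induction k with
  | zero => rw [pow_zero, pow_zero, L_zero le_rfl]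
  | succ k ih =>
    rw [L_rec, pow_succ', S, Finset.sum_mul]
    calc ∑ d ∈ Finset.Ioc 0 ⌊y⌋₊, P' d * (∑ n ∈ Finset.Ioc 0 ⌊y⌋₊, P' n) ^ k
        ≤ ∑ d ∈ Finset.Ioc 0 ⌊y⌋₊, P' d * L k (y ^ (k + 1) / d) := by
          refine Finset.sum_le_sum fun d hd => ?_
          refine mul_le_mul_of_nonneg_left (ih.trans (L_mono k ?_)) (P'_nonneg d)
          obtain ⟨h1, h2⟩ := Finset.mem_Ioc.1 hd
          have h3 : (0:ℝ) < d := by exact_mod_cast h1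
          have h4 : (d:ℝ) ≤ y := (Nat.le_floor_iff (by linarith)).1 h2
          rw [le_div_iff₀ h3, pow_succ]
          gcongr
      _ ≤ _ := by
          refine Finset.sum_le_sum_of_subset_of_nonneg ?_ ?_
          · exact Finset.Ioc_subset_Ioc_right (Nat.floor_le_floor (le_self_pow₀ hy (by simp)))
          · intro d _ _
            exact mul_nonneg (P'_nonneg d) (L_nonneg k _)

lemma M_tendsto : Tendsto (S P') atTop atTop := by
  have h := mertens.pos_mul_atTop one_pos loglog_tendsto
  refine h.congr' ?_
  filter_upwards [loglog_tendsto.eventually_gt_atTop 0] with x hx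
  field_simp

lemma L_ratio (k : ℕ) : Tendsto (fun x => L k x / (S P' x) ^ k) atTop (𝓝 1) := by
  rcases Nat.eq_zero_or_pos k with rfl | hk
  · refine tendsto_const_nhds.congr' ?_
    filter_upwards [eventually_ge_atTop 1] with x hx
    rw [L_zero hx]; simp
  have hk0 : (0:ℝ) < k := by exact_mod_cast hk
  have h1 : Tendsto (fun x : ℝ => x ^ ((k:ℝ)⁻¹)) atTop atTop :=
    tendsto_rpow_atTop (by positivity)
  have h2 : Tendsto (fun x : ℝ => Real.log (Real.log (x ^ ((k:ℝ)⁻¹))) / Real.log (Real.log x))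
      atTop (𝓝 1) := by
    have h3 : Tendsto (fun x : ℝ => 1 + Real.log ((k:ℝ)⁻¹) * (Real.log (Real.log x))⁻¹)
        atTop (𝓝 (1 + Real.log ((k:ℝ)⁻¹) * 0)) :=
      (loglog_tendsto.inv_tendsto_atTop.const_mul _).const_add 1
    rw [mul_zero, add_zero] at h3
    refine h3.congr' ?_
    filter_upwards [loglog_tendsto.eventually_gt_atTop 0, eventually_gt_atTop 1] with x hx hx1
    have := Real.log_pos hx1
    rw [Real.log_rpow (by linarith), Real.log_mul (by positivity) this.ne']
    field_simp
    ring
  have h4 : Tendsto (fun x : ℝ => S P' (x ^ ((k:ℝ)⁻¹)) / S P' x) atTop (𝓝 1) := by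
    have := ((mertens.comp h1).mul h2).div mertens one_ne_zero
    simp only [mul_one, div_one] at this
    refine this.congr' ?_
    filter_upwards [loglog_tendsto.eventually_gt_atTop 0,
      (loglog_tendsto.comp h1).eventually_gt_atTop 0] with x hx hx'
    simp only [Function.comp_def, Pi.div_apply] at hx' ⊢
    generalize x ^ ((k:ℝ)⁻¹) = y at hx' ⊢
    field_simp
  have h5 := h4.pow k
  rw [one_pow] at h5
  refine tendsto_of_tendsto_of_tendsto_of_le_of_le' h5 tendsto_const_nhds ?_ ?_
  · filter_upwards [eventually_ge_atTop 1] with x hx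
    rw [div_pow]
    have h6 := le_L k (Real.one_le_rpow hx (by positivity : (0:ℝ) ≤ (k:ℝ)⁻¹))
    rw [Real.rpow_inv_natCast_pow (by linarith) hk.ne'] at h6
    have := S_nonneg P'_nonneg x
    gcongr
  · filter_upwards [eventually_ge_atTop 1] with x hx
    exact div_le_one_of_le₀ (L_le k hx) (pow_nonneg (S_nonneg P'_nonneg x) k)

lemma E_bdd (k : ℕ) (H : ∀ ε > 0, ∀ᶠ x in atTop, |E k x| ≤ ε * x * (S P' x) ^ k) :
    ∀ ε > 0, ∃ C, 0 ≤ C ∧ ∀ x ≥ 1, |E k x| ≤ ε * x * (S P' x) ^ k + C := by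
  intro ε hε
  obtain ⟨X, hX1, hX⟩ := ((eventually_ge_atTop (1:ℝ)).and
    (eventually_forall_ge_atTop.2 (H ε hε))).exists
  have hT := T_nonneg (k+1) X
  have hL := L_nonneg k X
  refine ⟨T (k+1) X + (k+1) * X * L k X, by positivity, fun x hx => ?_⟩
  have hM := S_nonneg P'_nonneg x
  rcases le_total X x with h | h
  · have := hX x h
    have : 0 ≤ T (k+1) X + (k+1) * X * L k X := by positivity
    linarith [hX x h]
  · have h1 : T (k+1) x ≤ T (k+1) X := T_mono _ h
    have h2 : (k+1) * x * L k x ≤ (k+1) * X * L k X := by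
      have := L_mono k h
      have := L_nonneg k x
      gcongr
    have h3 := T_nonneg (k+1) x
    have h4 : 0 ≤ (k+1) * x * L k x := by
      have := L_nonneg k x
      positivity
    have h5 : 0 ≤ ε * x * (S P' x) ^ k := by positivity
    unfold E
    rw [abs_le]
    constructor <;> linarith

lemma E_small (k : ℕ) : ∀ ε > 0, ∀ᶠ x in atTop, |E k x| ≤ ε * x * (S P' x) ^ k := by
  induction k with
  | zero =>
    intro ε hε
    have := (Metric.tendsto_nhds.1 theta_pnt) ε hε
    filter_upwards [this, eventually_ge_atTop 1] with x hx hx1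
    have hx0 : 0 < x := by linarith
    rw [Real.dist_eq, div_sub_one hx0.ne', abs_div, abs_of_pos hx0, div_lt_iff₀ hx0] at hx
    unfold E
    rw [zero_add, T_one, L_zero hx1]
    simpa using hx.le
  | succ k ih =>
    have ih' := E_bdd k ih
    intro ε hε
    obtain ⟨C, hC0, hC⟩ := ih' (ε / 4) (by positivity)
    have hbig : ∀ᶠ x in atTop, C ≤ ε / 4 * (S P' x) ^ (k + 1) := by
      have : Tendsto (fun x => ε / 4 * (S P' x) ^ (k + 1)) atTop atTop :=
        ((tendsto_pow_atTop (Nat.succ_ne_zero k)).comp M_tendsto).const_mul_atTop (by positivity)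
      exact this.eventually_ge_atTop C
    filter_upwards [hbig, eventually_ge_atTop 1] with x hx hx1
    have hM := S_nonneg P'_nonneg x
    have hsum : |∑ d ∈ Finset.Ioc 0 ⌊x⌋₊, P d * E k (x / d)| ≤ ε / 4 * x * (S P' x) ^ (k+1) + C * x := by
      calc |∑ d ∈ Finset.Ioc 0 ⌊x⌋₊, P d * E k (x / d)|
          ≤ ∑ d ∈ Finset.Ioc 0 ⌊x⌋₊, |P d * E k (x / d)| := Finset.abs_sum_le_sum_abs _ _
        _ ≤ ∑ d ∈ Finset.Ioc 0 ⌊x⌋₊, (P' d * (ε / 4 * x * (S P' x) ^ k) + C) := by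
            refine Finset.sum_le_sum fun d hd => ?_
            obtain ⟨h1, h2⟩ := Finset.mem_Ioc.1 hd
            have h3 : (0:ℝ) < d := by exact_mod_cast h1
            have h4 : (d:ℝ) ≤ x := (Nat.le_floor_iff (by linarith)).1 h2
            have h5 := hC (x / d) (by rw [ge_iff_le, le_div_iff₀ h3]; linarith)
            have h6 : S P' (x / d) ≤ S P' x := S_mono P'_nonneg
              (div_le_self (by linarith) (by exact_mod_cast h1))
            have h7 := S_nonneg P'_nonneg (x / d)
            rw [abs_mul, abs_of_nonneg (P_nonneg d)]
            have h8 : |E k (x / d)| ≤ ε / 4 * (x / d) * (S P' x) ^ k + C := h5.trans (by gcongr)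
            calc P d * |E k (x / d)| ≤ P d * (ε / 4 * (x / d) * (S P' x) ^ k + C) :=
                  mul_le_mul_of_nonneg_left h8 (P_nonneg d)
              _ = P' d * (ε / 4 * x * (S P' x) ^ k) + P d * C := by rw [P'_eq]; ring
              _ ≤ _ := by
                have := mul_le_mul_of_nonneg_right (P_le_one d) hC0
                linarith
        _ = S P' x * (ε / 4 * x * (S P' x) ^ k) + ⌊x⌋₊ * C := by
            rw [Finset.sum_add_distrib, ← Finset.sum_mul]; simp [S]
        _ ≤ _ := by
            have := mul_le_mul_of_nonneg_right (Nat.floor_le (by linarith : 0 ≤ x)) hC0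
            rw [pow_succ]
            linarith
    have hCx : C * x ≤ ε / 4 * x * (S P' x) ^ (k+1) := by
      have := mul_le_mul_of_nonneg_right hx (by linarith : 0 ≤ x)
      linarith
    have hrec := congrArg abs (E_rec k x)
    rw [abs_mul, abs_mul, abs_of_pos (by positivity : (0:ℝ) < k + 1),
      abs_of_pos (by positivity : (0:ℝ) < k + 2)] at hrec
    have hfin : (k + 1 : ℝ) * |E (k+1) x| ≤ (k + 1 : ℝ) * (ε * x * (S P' x) ^ (k+1)) := by
      rw [hrec]
      have hz : 0 ≤ ε / 4 * x * (S P' x) ^ (k+1) := by positivity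
      calc (k + 2 : ℝ) * |∑ d ∈ Finset.Ioc 0 ⌊x⌋₊, P d * E k (x / d)|
          ≤ (2 * (k + 1) : ℝ) * (2 * (ε / 4 * x * (S P' x) ^ (k+1))) := by
            gcongr
            · have : (0:ℝ) ≤ k := Nat.cast_nonneg k
              linarith
            · linarith
        _ = _ := by ring
    exact le_of_mul_le_mul_left hfin (by positivity)

/-- number of prime factors with multiplicity -/
abbrev Om (n : ℕ) : ℕ := ArithmeticFunction.cardFactors n

lemma card_primeFactors_le (n : ℕ) : n.primeFactors.card ≤ Om n := by
  unfold Om Nat.primeFactors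
  rw [List.card_toFinset, ArithmeticFunction.cardFactors_apply]
  exact (List.dedup_sublist _).length_le

lemma card_primeFactors_eq {n : ℕ} (h : Squarefree n) : n.primeFactors.card = Om n := by
  have h1 := (ArithmeticFunction.cardDistinctFactors_eq_cardFactors_iff_squarefree h.ne_zero).2 h
  rw [ArithmeticFunction.cardDistinctFactors_apply] at h1
  unfold Om Nat.primeFactors
  rw [List.card_toFinset, h1]

lemma Om_mul_prime {m p : ℕ} (hm : m ≠ 0) (hp : p.Prime) : Om (m * p) = Om m + 1 := by
  unfold Om
  rw [ArithmeticFunction.cardFactors_mul hm hp.ne_zero,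
    ArithmeticFunction.cardFactors_apply_prime hp]

lemma div_facts {n p : ℕ} (hp : p ∈ n.primeFactors) :
    n / p ≠ 0 ∧ Om n = Om (n / p) + 1 ∧ n / p * p = n := by
  obtain ⟨h1, h2, h3⟩ := Nat.mem_primeFactors.1 hp
  have h4 : n / p * p = n := Nat.div_mul_cancel h2
  have h5 : n / p ≠ 0 := by
    intro h; rw [h, zero_mul] at h4; exact h3 h4.symm
  refine ⟨h5, ?_, h4⟩
  rw [← Om_mul_prime h5 h1, h4]

lemma P_mul_apply (f : ArithmeticFunction ℝ) (n : ℕ) :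
    (P * f) n = ∑ p ∈ n.primeFactors, f (n / p) := by
  rw [ArithmeticFunction.mul_apply, Nat.sum_divisorsAntidiagonal (fun a b => P a * f b),
    Nat.primeFactors_eq_to_filter_divisors_prime, Finset.sum_filter]
  refine Finset.sum_congr rfl fun p _ => ?_
  rw [P_apply]; split_ifs <;> simp

lemma P_pow_eq_zero (k : ℕ) : ∀ {n : ℕ}, n ≠ 0 → Om n ≠ k → (P ^ k) n = 0 := by
  induction k with
  | zero =>
    intro n _ h
    rw [pow_zero]
    apply ArithmeticFunction.one_apply_ne
    rintro rfl
    exact h ArithmeticFunction.cardFactors_one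
  | succ k ih =>
    intro n _ h
    rw [pow_succ', P_mul_apply]
    refine Finset.sum_eq_zero fun p hp => ?_
    obtain ⟨h1, h2, _⟩ := div_facts hp
    exact ih h1 (by omega)

lemma P_pow_le (k : ℕ) : ∀ n : ℕ, (P ^ k) n ≤ k.factorial := by
  induction k with
  | zero =>
    intro n
    rw [pow_zero, ArithmeticFunction.one_apply]; split_ifs <;> simp
  | succ k ih =>
    intro n
    rcases eq_or_ne n 0 with rfl | hn
    · rw [ArithmeticFunction.map_zero]; positivity
    by_cases h : Om n = k + 1
    · rw [pow_succ', P_mul_apply]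
      calc ∑ p ∈ n.primeFactors, (P ^ k) (n / p) ≤ ∑ p ∈ n.primeFactors, (k.factorial : ℝ) :=
            Finset.sum_le_sum fun p _ => ih _
        _ = n.primeFactors.card * (k.factorial : ℝ) := by simp
        _ ≤ ((k + 1 : ℕ) : ℝ) * (k.factorial : ℝ) := by
            gcongr
            exact (card_primeFactors_le n).trans h.le
        _ = _ := by rw [Nat.factorial_succ]; push_cast; ring
    · rw [P_pow_eq_zero _ hn h]; positivity

lemma one_le_P_pow (k : ℕ) : ∀ {n : ℕ}, n ≠ 0 → Om n = k → 1 ≤ (P ^ k) n := by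
  induction k with
  | zero =>
    intro n hn h
    have : n = 1 := by
      rcases ArithmeticFunction.cardFactors_eq_zero_iff_eq_zero_or_one.1 h with h | h
      · exact absurd h hn
      · exact h
    subst this
    simp
  | succ k ih =>
    intro n hn h
    have hn1 : n ≠ 1 := by
      rintro rfl
      rw [Om, ArithmeticFunction.cardFactors_one] at h
      omega
    obtain ⟨p, hp, hpn⟩ := Nat.exists_prime_and_dvd hn1
    have hp' : p ∈ n.primeFactors := Nat.mem_primeFactors.2 ⟨hp, hpn, hn⟩
    obtain ⟨h1, h2, _⟩ := div_facts hp'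
    rw [pow_succ', P_mul_apply]
    refine (ih h1 (by omega)).trans ?_
    exact Finset.single_le_sum (f := fun p => (P ^ k) (n / p))
      (fun q _ => pow_nonneg' P_nonneg k _) hp'

lemma P_pow_squarefree (k : ℕ) : ∀ {n : ℕ}, Squarefree n → Om n = k →
    (P ^ k) n = k.factorial := by
  induction k with
  | zero =>
    intro n hn h
    have : n = 1 := by
      rcases ArithmeticFunction.cardFactors_eq_zero_iff_eq_zero_or_one.1 h with h | h
      · exact absurd h hn.ne_zero
      · exact h
    subst this
    simp
  | succ k ih =>
    intro n hn h
    rw [pow_succ', P_mul_apply]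
    have : ∀ p ∈ n.primeFactors, (P ^ k) (n / p) = k.factorial := by
      intro p hp
      obtain ⟨h1, h2, h3⟩ := div_facts hp
      exact ih (hn.squarefree_of_dvd ⟨p, h3.symm⟩) (by omega)
    rw [Finset.sum_congr rfl this, Finset.sum_const, card_primeFactors_eq hn, h,
      Nat.factorial_succ]
    simp

/-- the number of products of `s` distinct primes up to `x` -/
noncomputable def Q (s : ℕ) (x : ℝ) : ℝ :=
  (((Finset.Icc 1 ⌊x⌋₊).filter (fun n => Squarefree n ∧ n.primeFactors.card = s)).card : ℝ)

/-- the products of `s` distinct primes up to `N` -/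
noncomputable def QS (s N : ℕ) : Finset ℕ :=
  (Finset.Ioc 0 N).filter (fun n => Squarefree n ∧ n.primeFactors.card = s)

lemma Q_eq (s : ℕ) (x : ℝ) : Q s x = (QS s ⌊x⌋₊).card := rfl

lemma Q_lower (s : ℕ) (x : ℝ) : s.factorial * Q s x ≤ S (P ^ s) x := by
  rw [Q_eq, S]
  calc (s.factorial : ℝ) * (QS s ⌊x⌋₊).card = ∑ n ∈ QS s ⌊x⌋₊, (P ^ s) n := by
        rw [Finset.sum_congr rfl (g := fun _ => (s.factorial : ℝ)), Finset.sum_const,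
          nsmul_eq_mul, mul_comm]
        intro n hn
        obtain ⟨_, h1, h2⟩ := Finset.mem_filter.1 hn
        exact P_pow_squarefree s h1 (by rw [← card_primeFactors_eq h1, h2])
    _ ≤ _ := Finset.sum_le_sum_of_subset_of_nonneg (Finset.filter_subset _ _)
        (fun n _ _ => pow_nonneg' P_nonneg s n)

/-- the non-squarefree products of `s` primes up to `N` -/
noncomputable def NS (s N : ℕ) : Finset ℕ :=
  (Finset.Ioc 0 N).filter (fun n => Om n = s ∧ ¬ Squarefree n)

lemma NS_card (k : ℕ) (x : ℝ) : ((NS (k + 1) ⌊x⌋₊).card : ℝ) ≤ k * S (P ^ k) x := by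
  set A : Finset ℕ := (Finset.Ioc 0 ⌊x⌋₊).filter (fun n => Om n = k) with hA
  have hsub : NS (k + 1) ⌊x⌋₊ ⊆ A.biUnion (fun m => m.primeFactors.image (fun p => m * p)) := by
    intro n hn
    obtain ⟨h1, h2, h3⟩ := Finset.mem_filter.1 hn
    obtain ⟨h4, h5⟩ := Finset.mem_Ioc.1 h1
    rw [Nat.squarefree_iff_prime_squarefree] at h3
    push Not at h3
    obtain ⟨p, hp, hpn⟩ := h3
    have hp' : p ∈ n.primeFactors :=
      Nat.mem_primeFactors.2 ⟨hp, (dvd_mul_right p p).trans hpn, h4.ne'⟩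
    obtain ⟨h6, h7, h8⟩ := div_facts hp'
    refine Finset.mem_biUnion.2 ⟨n / p, ?_, Finset.mem_image.2 ⟨p, ?_, h8⟩⟩
    · refine Finset.mem_filter.2 ⟨Finset.mem_Ioc.2 ⟨Nat.pos_of_ne_zero h6, ?_⟩, by omega⟩
      exact (Nat.div_le_self n p).trans h5
    · refine Nat.mem_primeFactors.2 ⟨hp, ?_, h6⟩
      exact Nat.dvd_div_of_mul_dvd hpn
  have h1 : (NS (k + 1) ⌊x⌋₊).card ≤ ∑ m ∈ A, k := by
    refine (Finset.card_le_card hsub).trans (Finset.card_biUnion_le.trans ?_)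
    refine Finset.sum_le_sum fun m hm => ?_
    exact Finset.card_image_le.trans
      ((card_primeFactors_le m).trans (Finset.mem_filter.1 hm).2.le)
  calc ((NS (k + 1) ⌊x⌋₊).card : ℝ) ≤ ((∑ m ∈ A, k : ℕ) : ℝ) := by exact_mod_cast h1
    _ = ∑ m ∈ A, (k : ℝ) * 1 := by push_cast; simp
    _ ≤ ∑ m ∈ A, (k : ℝ) * (P ^ k) m := by
        refine Finset.sum_le_sum fun m hm => ?_
        obtain ⟨h2, h3⟩ := Finset.mem_filter.1 hm
        gcongr
        exact one_le_P_pow k (Finset.mem_Ioc.1 h2).1.ne' h3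
    _ = k * ∑ m ∈ A, (P ^ k) m := by rw [Finset.mul_sum]
    _ ≤ _ := by
        rw [S]
        gcongr
        · intro n _ _
          exact pow_nonneg' P_nonneg k n
        · exact Finset.filter_subset _ _

lemma Q_upper (k : ℕ) (x : ℝ) : S (P ^ (k + 1)) x ≤
    (k + 1).factorial * Q (k + 1) x + (k + 1).factorial * (k * S (P ^ k) x) := by
  have h1 : S (P ^ (k + 1)) x ≤ (k + 1).factorial * Q (k + 1) x +
      (k + 1).factorial * ((NS (k + 1) ⌊x⌋₊).card : ℝ) := by
    rw [Q_eq, S]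
    have h2 : ∀ n ∈ Finset.Ioc 0 ⌊x⌋₊, (P ^ (k + 1)) n ≤
        (if Squarefree n ∧ n.primeFactors.card = k + 1 then ((k + 1).factorial : ℝ) else 0) +
        (if Om n = k + 1 ∧ ¬ Squarefree n then ((k + 1).factorial : ℝ) else 0) := by
      intro n hn
      have hf : (0:ℝ) ≤ ((k + 1).factorial : ℝ) := by positivity
      have hn0 : n ≠ 0 := (Finset.mem_Ioc.1 hn).1.ne'
      by_cases h : Om n = k + 1
      · have h3 := P_pow_le (k + 1) n
        by_cases hs : Squarefree n
        · rw [if_pos ⟨hs, by rw [card_primeFactors_eq hs, h]⟩, if_neg (by tauto)]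
          linarith
        · rw [if_neg (by tauto), if_pos ⟨h, hs⟩]
          linarith
      · rw [P_pow_eq_zero _ hn0 h]
        split_ifs <;> linarith
    refine (Finset.sum_le_sum h2).trans ?_
    rw [Finset.sum_add_distrib, ← Finset.sum_filter, ← Finset.sum_filter, Finset.sum_const,
      Finset.sum_const, nsmul_eq_mul, nsmul_eq_mul, mul_comm, mul_comm ((Finset.card _ : ℕ) : ℝ) _]
    exact le_rfl
  refine h1.trans ?_
  gcongr
  exact NS_card k x

lemma T_ratio (k : ℕ) : Tendsto (fun x => T (k + 1) x / (x * (Real.log (Real.log x)) ^ k))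
    atTop (𝓝 (k + 1)) := by
  have hE : Tendsto (fun x => E k x / (x * (S P' x) ^ k)) atTop (𝓝 0) := by
    rw [Metric.tendsto_nhds]
    intro ε hε
    filter_upwards [E_small k (ε / 2) (by positivity), eventually_gt_atTop 0,
      M_tendsto.eventually_gt_atTop 0] with x hx hx0 hM
    have h0 : 0 < x * (S P' x) ^ k := by positivity
    rw [Real.dist_eq, sub_zero, abs_div, abs_of_pos h0, div_lt_iff₀ h0]
    nlinarith
  have h1 := (hE.add ((L_ratio k).const_mul ((k:ℝ) + 1))).mul (mertens.pow k)
  rw [zero_add, mul_one, one_pow, mul_one] at h1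
  refine h1.congr' ?_
  filter_upwards [eventually_gt_atTop 0, M_tendsto.eventually_gt_atTop 0,
    loglog_tendsto.eventually_gt_atTop 0] with x hx hM hl
  unfold E
  rw [div_pow]
  field_simp
  ring

lemma Pi_ratio (k : ℕ) : Tendsto
    (fun x => S (P ^ (k + 1)) x * Real.log x / (x * (Real.log (Real.log x)) ^ k))
    atTop (𝓝 (k + 1)) := by
  have hlog := Real.tendsto_log_atTop
  have hll : Tendsto (fun x => Real.log (Real.log x) / Real.log x) atTop (𝓝 0) :=
    Real.isLittleO_log_id_atTop.tendsto_div_nhds_zero.comp hlog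
  have hden : Tendsto (fun x => 1 - 2 * (Real.log (Real.log x) / Real.log x)) atTop (𝓝 1) := by
    simpa using (hll.const_mul 2).const_sub 1
  have hU := ((T_ratio k).add (hlog.inv_tendsto_atTop.const_mul ((k + 1).factorial : ℝ))).div
    hden one_ne_zero
  rw [mul_zero, add_zero, div_one] at hU
  refine tendsto_of_tendsto_of_tendsto_of_le_of_le' (T_ratio k) hU ?_ ?_
  · filter_upwards [eventually_gt_atTop 1, loglog_tendsto.eventually_gt_atTop 0] with x hx hl
    have : T (k + 1) x ≤ S (P ^ (k + 1)) x * Real.log x := by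
      rw [T, S, S, Finset.sum_mul]
      refine Finset.sum_le_sum fun n hn => ?_
      rw [D_apply]
      obtain ⟨h1, h2⟩ := Finset.mem_Ioc.1 hn
      have h3 : (0:ℝ) < n := by exact_mod_cast h1
      have h4 : (n:ℝ) ≤ x := (Nat.le_floor_iff (by linarith)).1 h2
      exact mul_le_mul_of_nonneg_left (Real.log_le_log h3 h4) (pow_nonneg' P_nonneg _ n)
    gcongr
  · filter_upwards [eventually_gt_atTop 1, loglog_tendsto.eventually_ge_atTop 1,
      hlog.eventually_gt_atTop 1, hden.eventually_const_lt one_pos] with x hx hl hl1 hd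
    simp only [Pi.div_apply, Pi.inv_apply]
    set l := Real.log x with hldef
    set y := x / l ^ 2 with hy
    have hx0 : 0 < x := by linarith
    have hl0 : 0 < l := by linarith
    have hy0 : 0 < y := by positivity
    have hlogy : Real.log y = l * (1 - 2 * (Real.log l / l)) := by
      rw [hy, Real.log_div hx0.ne' (by positivity), Real.log_pow]
      field_simp
      push_cast
      ring
    have hF : (0:ℝ) ≤ ((k + 1).factorial : ℝ) := by positivity
    have hylx : y ≤ x := div_le_self hx0.le (one_le_pow₀ hl1.le)
    have hlogy0 : 0 < Real.log y := by rw [hlogy]; positivity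
    have hmain : S (P ^ (k + 1)) x * Real.log y ≤
        T (k + 1) x + y * ((k + 1).factorial * l) := by
      have h1 : S (P ^ (k + 1)) x * Real.log y ≤
          T (k + 1) x + ∑ n ∈ Finset.Ioc 0 ⌊y⌋₊, ((k + 1).factorial * l) := by
        have hsub : Finset.Ioc 0 ⌊y⌋₊ ⊆ Finset.Ioc 0 ⌊x⌋₊ :=
          Finset.Ioc_subset_Ioc_right (Nat.floor_le_floor hylx)
        rw [T, S, S, Finset.sum_mul, ← Finset.inter_eq_right.2 hsub, ← Finset.sum_ite_mem,
          ← Finset.sum_add_distrib]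
        refine Finset.sum_le_sum fun n hn => ?_
        obtain ⟨h1, h2⟩ := Finset.mem_Ioc.1 hn
        have hfn := pow_nonneg' P_nonneg (k + 1) n
        rw [D_apply]
        split_ifs with h
        · have h3 : (P ^ (k + 1)) n * Real.log y ≤ (k + 1).factorial * l := by
            apply mul_le_mul (P_pow_le _ n) (Real.log_le_log hy0 hylx) hlogy0.le hF
          have h4 := mul_nonneg hfn (Real.log_natCast_nonneg n)
          linarith
        · have h3 : y ≤ n := by
            by_contra hc
            push Not at hc
            exact h (Finset.mem_Ioc.2 ⟨h1, Nat.le_floor hc.le⟩)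
          rw [add_zero]
          exact mul_le_mul_of_nonneg_left (Real.log_le_log hy0 h3) hfn
      refine h1.trans ?_
      rw [Finset.sum_const, Nat.card_Ioc, Nat.sub_zero, nsmul_eq_mul]
      gcongr
      exact Nat.floor_le hy0.le
    set d := 1 - 2 * (Real.log l / l) with hddef
    set m := Real.log l with hm
    have hmk : 1 ≤ m ^ k := one_le_pow₀ hl
    have hm0 : 0 < m := by linarith
    rw [le_div_iff₀ hd]
    calc S (P ^ (k + 1)) x * l / (x * m ^ k) * d
        = (S (P ^ (k + 1)) x * Real.log y) / (x * m ^ k) := by rw [hlogy]; ring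
      _ ≤ (T (k + 1) x + y * ((k + 1).factorial * l)) / (x * m ^ k) := by gcongr
      _ = T (k + 1) x / (x * m ^ k) + (k + 1).factorial * l⁻¹ / m ^ k := by
          rw [hy]; field_simp
      _ ≤ _ := by
          gcongr
          exact div_le_self (by positivity) hmk

theorem Q_ratio (k : ℕ) : Tendsto (fun x => Q (k + 1) x /
    (x * (Real.log (Real.log x)) ^ k / Real.log x / k.factorial)) atTop (𝓝 1) := by
  have hB : Tendsto (fun x => k * S (P ^ k) x * Real.log x / (x * (Real.log (Real.log x)) ^ k))
      atTop (𝓝 0) := by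
    rcases k with _ | j
    · simp
    · have h := ((Pi_ratio j).mul loglog_tendsto.inv_tendsto_atTop).const_mul ((j + 1 : ℕ) : ℝ)
      rw [mul_zero, mul_zero] at h
      refine h.congr fun x => ?_
      simp only [Pi.inv_apply]
      rw [pow_succ, ← mul_assoc, ← div_div]
      ring
  have hA := (Pi_ratio k).div_const ((k:ℝ) + 1)
  rw [div_self (by positivity)] at hA
  have hlow := hA.sub (hB.const_mul (k.factorial : ℝ))
  rw [mul_zero, sub_zero] at hlow
  have key : ∀ᶠ x : ℝ in atTop, 0 < Real.log x / (x * (Real.log (Real.log x)) ^ k) := by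
    filter_upwards [eventually_gt_atTop 1, loglog_tendsto.eventually_gt_atTop 0] with x hx hl
    have := Real.log_pos hx
    positivity
  have hf : ((k + 1).factorial : ℝ) = (k + 1) * k.factorial := by
    rw [Nat.factorial_succ]; push_cast; ring
  have heq : ∀ x : ℝ, Q (k + 1) x /
      (x * (Real.log (Real.log x)) ^ k / Real.log x / k.factorial) =
      k.factorial * Q (k + 1) x * (Real.log x / (x * (Real.log (Real.log x)) ^ k)) := by
    intro x
    rw [div_div, div_div_eq_mul_div, div_eq_mul_inv, div_eq_mul_inv]
    ring
  refine tendsto_of_tendsto_of_tendsto_of_le_of_le' hlow hA ?_ ?_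
  · filter_upwards [key] with x hx
    rw [heq]
    have h := mul_le_mul_of_nonneg_right (Q_upper k x) hx.le
    rw [hf] at h
    rw [mul_div_assoc (S (P ^ (k + 1)) x) (Real.log x), mul_div_assoc _ (Real.log x)]
    generalize Real.log x / (x * (Real.log (Real.log x)) ^ k) = z at *
    rw [sub_le_iff_le_add, div_le_iff₀ (by positivity)]
    linarith
  · filter_upwards [key] with x hx
    rw [heq]
    have h := mul_le_mul_of_nonneg_right (Q_lower (k + 1) x) hx.le
    rw [hf] at h
    rw [mul_div_assoc]
    generalize Real.log x / (x * (Real.log (Real.log x)) ^ k) = z at *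
    rw [le_div_iff₀ (by positivity)]
    linarith

end LandauPNT

theorem landau_squarefree (s : ℕ) (hs : 1 ≤ s) :
    Filter.Tendsto (fun x : ℝ =>
      (((Finset.Icc 1 ⌊x⌋₊).filter (fun n =>
          Squarefree n ∧ n.primeFactors.card = s)).card : ℝ) /
        (x * (Real.log (Real.log x)) ^ (s - 1) / Real.log x / (Nat.factorial (s - 1))))
      Filter.atTop (nhds 1) := by
  obtain ⟨k, rfl⟩ : ∃ k, s = k + 1 := ⟨s - 1, by omega⟩
  exact LandauPNT.Q_ratio k
end

section
/- For every ε ∈ (0,1), the set of (k-near-perfect numbers for threshold (log y)^{log 2 + ε}) contains, for each fixed m ∈ N(k) (a k-near-perfect number) with k fixed, all numbers n = m·m' where m' is squarefree, coprime to m, Ω(m') ≤ (1 + ε/(2 log 2)) log log m', and m' is sufficiently large. Consequently the lower density of N((log y)^{log 2+ε}) is at least (6/π²)·φ(m)/m². -/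
lemma npt_len {n : ℕ} (h : Squarefree n) : n.primeFactorsList.length = n.primeFactors.card := by
  rw [Nat.primeFactors, List.toFinset_card_of_nodup]
  exact (Nat.squarefree_iff_nodup_primeFactorsList h.ne_zero).1 h

lemma npt_tau {n : ℕ} (h : Squarefree n) : n.divisors.card = 2 ^ n.primeFactors.card := by
  rw [Nat.card_divisors h.ne_zero]
  apply Finset.prod_eq_pow_card
  intro p hp
  have := Squarefree.natFactorization_le_one p h
  have h2 := (Nat.prime_of_mem_primeFactors hp).factorization_pos_of_dvd h.ne_zero
    (Nat.dvd_of_mem_primeFactors hp)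
  omega

lemma npt_mul_inj {m m' : ℕ} (hm : 0 < m) (h : Nat.Coprime m m') :
    Set.InjOn (fun q : ℕ × ℕ => q.1 * q.2) (↑(m.divisors ×ˢ m'.divisors) : Set (ℕ × ℕ)) := by
  rintro ⟨a, b⟩ hab ⟨c, d⟩ hcd he
  simp only [Finset.coe_product, Set.mem_prod, Finset.mem_coe, Nat.mem_divisors] at hab hcd he
  have key : ∀ x y : ℕ, x ∣ m → y ∣ m' → (x * y).gcd m = x := by
    intro x y hx hy
    have : Nat.Coprime y m := (Nat.Coprime.coprime_dvd_right hy h).symm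
    rw [Nat.Coprime.gcd_mul_right_cancel _ this]
    exact Nat.gcd_eq_left hx
  have h1 : a = c := by
    rw [← key a b hab.1.1 hab.2.1, ← key c d hcd.1.1 hcd.2.1, he]
  subst h1
  have ha : 0 < a := Nat.pos_of_dvd_of_pos hab.1.1 hm
  have := Nat.eq_of_mul_eq_mul_left ha he
  simp [this]

lemma npt_construct {m m' : ℕ} (hm : 0 < m) (hm' : 0 < m') (h : Nat.Coprime m m')
    {D : Finset ℕ} (hD : D ⊆ m.properDivisors)
    (hs : ArithmeticFunction.sigma 1 m = 2 * m + ∑ d ∈ D, d) :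
    ∃ D' ⊆ (m * m').properDivisors, D'.card ≤ D.card + m.divisors.card * m'.divisors.card ∧
      ArithmeticFunction.sigma 1 (m * m') = 2 * (m * m') + ∑ d ∈ D', d := by
  classical
  set T : Finset (ℕ × ℕ) := (D ×ˢ {m'}) ∪ (m.divisors ×ˢ m'.properDivisors) with hT
  have hDd : D ⊆ m.divisors := hD.trans (Nat.properDivisors_subset_divisors)
  have hTs : T ⊆ m.divisors ×ˢ m'.divisors := by
    intro q hq
    simp only [hT, Finset.mem_union, Finset.mem_product, Finset.mem_singleton] at hq ⊢
    rcases hq with hq | hq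
    · exact ⟨hDd hq.1, by rw [hq.2]; exact Nat.mem_divisors_self _ hm'.ne'⟩
    · exact ⟨hq.1, Nat.properDivisors_subset_divisors hq.2⟩
  have hdisj : Disjoint (D ×ˢ {m'}) (m.divisors ×ˢ m'.properDivisors) := by
    rw [Finset.disjoint_left]
    rintro ⟨a, b⟩ h1 h2
    simp only [Finset.mem_product, Finset.mem_singleton, Nat.mem_properDivisors] at h1 h2
    omega
  have hinj : Set.InjOn (fun q : ℕ × ℕ => q.1 * q.2) (↑T : Set (ℕ × ℕ)) :=
    (npt_mul_inj hm h).mono (by exact_mod_cast hTs)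
  refine ⟨T.image (fun q => q.1 * q.2), ?_, ?_, ?_⟩
  · intro x hx
    rw [Finset.mem_image] at hx
    obtain ⟨⟨a, b⟩, hq, rfl⟩ := hx
    have h1 := hTs hq
    simp only [Finset.mem_product, Nat.mem_divisors] at h1
    rw [Nat.mem_properDivisors]
    refine ⟨mul_dvd_mul h1.1.1 h1.2.1, ?_⟩
    have ha := Nat.le_of_dvd hm h1.1.1
    have hb := Nat.le_of_dvd hm' h1.2.1
    simp only [hT, Finset.mem_union, Finset.mem_product, Finset.mem_singleton] at hq
    rcases hq with hq | hq
    · have := (Nat.mem_properDivisors.1 (hD hq.1)).2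
      have h2 := hq.2
      simp only at h2 this ⊢
      rw [h2]
      exact Nat.mul_lt_mul_of_pos_right this hm'
    · have := (Nat.mem_properDivisors.1 hq.2).2
      simp only at this ⊢
      calc a * b ≤ m * b := Nat.mul_le_mul_right _ ha
        _ < m * m' := Nat.mul_lt_mul_of_pos_left this hm
  · refine Finset.card_image_le.trans ((Finset.card_union_le _ _).trans ?_)
    simp only [Finset.card_product, Finset.card_singleton, mul_one]
    gcongr
    exact Nat.properDivisors_subset_divisors
  · rw [Finset.sum_image hinj, hT, Finset.sum_union hdisj, Finset.sum_product, Finset.sum_product]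
    simp only [Finset.sum_singleton]
    rw [← Finset.sum_mul, ← Finset.sum_mul_sum,
      ArithmeticFunction.isMultiplicative_sigma.map_mul_of_coprime h]
    have h2 : ArithmeticFunction.sigma 1 m' = ∑ i ∈ m'.properDivisors, i + m' := by
      rw [ArithmeticFunction.sigma_one_apply, Nat.sum_divisors_eq_sum_properDivisors_add_self]
    rw [← ArithmeticFunction.sigma_one_apply, h2, hs]
    ring

lemma npt_part1 (ε : ℝ) (hε : 0 < ε)
    (k : ℕ) (m : ℕ) (hm : 0 < m)
    (hmk : ∃ D ⊆ m.properDivisors, D.card ≤ k ∧ ArithmeticFunction.sigma 1 m = 2 * m + ∑ d ∈ D, d) :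
    (∃ N₀ : ℕ, ∀ m' : ℕ, N₀ ≤ m' → Squarefree m' → Nat.Coprime m m' →
        (m'.primeFactorsList.length : ℝ) ≤
          (1 + ε / (2 * Real.log 2)) * Real.log (Real.log m') →
        ∃ D ⊆ (m * m').properDivisors,
          (D.card : ℝ) ≤ (Real.log (m * m')) ^ (Real.log 2 + ε) ∧
          ArithmeticFunction.sigma 1 (m * m') = 2 * (m * m') + ∑ d ∈ D, d) := by
  obtain ⟨D, hD, hk, hs⟩ := hmk
  have hl2 : 0 < Real.log 2 := Real.log_pos (by norm_num)
  have ht : Filter.Tendsto (fun n : ℕ => Real.log (n : ℝ)) Filter.atTop Filter.atTop :=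
    Real.tendsto_log_atTop.comp tendsto_natCast_atTop_atTop
  have ht2 : Filter.Tendsto (fun n : ℕ => Real.log (n : ℝ) ^ (ε / 2)) Filter.atTop Filter.atTop :=
    (tendsto_rpow_atTop (by positivity)).comp ht
  obtain ⟨N₀, hN⟩ := Filter.eventually_atTop.1 ((ht.eventually_ge_atTop 1).and
    (ht2.eventually_ge_atTop ((k : ℝ) + m.divisors.card)))
  refine ⟨N₀, fun m' hm' hsq hc hlen => ?_⟩
  obtain ⟨h1, h2⟩ := hN m' hm'
  have hm'0 : 0 < m' := Nat.pos_of_ne_zero hsq.ne_zero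
  obtain ⟨D', hD', hcard, hs'⟩ := npt_construct hm hm'0 hc hD hs
  refine ⟨D', hD', ?_, hs'⟩
  have htau : m'.divisors.card = 2 ^ m'.primeFactorsList.length := by
    rw [npt_len hsq, npt_tau hsq]
  set L := Real.log m' with hL
  have hL0 : 0 < L := by linarith
  have hp : (m'.divisors.card : ℝ) ≤ L ^ (Real.log 2 + ε / 2) := by
    rw [htau]
    push_cast
    rw [← Real.rpow_natCast, Real.rpow_def_of_pos (by norm_num : (0:ℝ) < 2), Real.rpow_def_of_pos hL0]
    apply Real.exp_le_exp.2
    calc Real.log 2 * _ ≤ Real.log 2 * ((1 + ε / (2 * Real.log 2)) * Real.log L) := by gcongr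
      _ = _ := by field_simp
  have hone : 1 ≤ L ^ (Real.log 2 + ε / 2) := Real.one_le_rpow h1 (by positivity)
  have hlog : L ≤ Real.log (m * m') := by
    apply Real.log_le_log (by exact_mod_cast hm'0)
    have : (1 : ℝ) ≤ m := by exact_mod_cast hm
    nlinarith [(by exact_mod_cast hm'0 : (0:ℝ) < m')]
  calc (D'.card : ℝ) ≤ D.card + m.divisors.card * m'.divisors.card := by exact_mod_cast hcard
    _ ≤ k * L ^ (Real.log 2 + ε / 2) + m.divisors.card * L ^ (Real.log 2 + ε / 2) := by
        have : (D.card : ℝ) ≤ k := by exact_mod_cast hk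
        have hk0 : (0:ℝ) ≤ k := by positivity
        gcongr
        nlinarith
    _ = (k + m.divisors.card) * L ^ (Real.log 2 + ε / 2) := by ring
    _ ≤ L ^ (ε / 2) * L ^ (Real.log 2 + ε / 2) := by gcongr
    _ = L ^ (Real.log 2 + ε) := by rw [← Real.rpow_add hL0]; congr 1; ring
    _ ≤ _ := by gcongr

section npt
open Filter Topology

/-- squarefree indicator via Moebius -/
lemma npt_sq_ind (n : ℕ) (hn : 0 < n) :
    (if Squarefree n then (1:ℝ) else 0) =
      ∑ d ∈ n.divisors with d ^ 2 ∣ n, (ArithmeticFunction.moebius d : ℝ) := by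
  obtain ⟨a, b, ha, hb, hab, hsq⟩ := Nat.sq_mul_squarefree_of_pos hn
  have hdiv : n.divisors.filter (fun d => d ^ 2 ∣ n) = b.divisors := by
    ext d
    simp only [Finset.mem_filter, Nat.mem_divisors]
    constructor
    · rintro ⟨-, h⟩
      refine ⟨?_, hb.ne'⟩
      have hd0 : d ≠ 0 := by rintro rfl; simp at h; omega
      rw [← hab] at h
      rw [← Nat.factorization_le_iff_dvd hd0 hb.ne']
      rw [← Nat.factorization_le_iff_dvd (by positivity) (by positivity),
        Nat.factorization_mul (by positivity) ha.ne', Nat.factorization_pow, Nat.factorization_pow] at h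
      intro p
      have h1 := h p
      have h2 := Squarefree.natFactorization_le_one p hsq
      simp only [Finsupp.add_apply, Finsupp.smul_apply, smul_eq_mul] at h1
      omega
    · rintro ⟨h, -⟩
      have : d ^ 2 ∣ n := by
        rw [← hab]; exact (pow_dvd_pow_of_dvd h 2).mul_right a
      exact ⟨⟨(dvd_pow_self d two_ne_zero).trans this, hn.ne'⟩, this⟩
  rw [hdiv]
  have h1 := ArithmeticFunction.coe_mul_zeta_apply (f := ArithmeticFunction.moebius) (x := b)
  rw [ArithmeticFunction.moebius_mul_coe_zeta, ArithmeticFunction.one_apply] at h1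
  have h2 : (Squarefree n) ↔ b = 1 := by
    constructor
    · intro h
      have := h b ⟨a, by rw [← hab]; ring⟩
      simpa using this
    · rintro rfl
      rw [← hab]; simpa using hsq
  simp only [h2]
  exact_mod_cast h1

noncomputable def nptA (m Y : ℕ) : ℕ := ((Finset.Icc 1 Y).filter (fun n => Nat.Coprime m n)).card
noncomputable def nptS (m Y : ℕ) : ℕ :=
  ((Finset.Icc 1 Y).filter (fun n => Squarefree n ∧ Nat.Coprime m n)).card
noncomputable def nptw (m d : ℕ) : ℝ :=
  if Nat.Coprime m d then (ArithmeticFunction.moebius d : ℝ) else 0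

lemma npt_A_mul (m q : ℕ) : nptA m (m * q) = m.totient * q := by
  induction q with
  | zero => simp [nptA]
  | succ q ih =>
    have h := Nat.filter_coprime_Ico_eq_totient m (m * q + 1)
    have hu : Finset.Icc 1 (m * (q+1)) = Finset.Icc 1 (m * q) ∪ Finset.Ico (m * q + 1) (m * q + 1 + m) := by
      ext x; simp only [Finset.mem_Icc, Finset.mem_union, Finset.mem_Ico, mul_add]; omega
    unfold nptA at *
    rw [hu, Finset.filter_union, Finset.card_union_of_disjoint, ih, h]
    · ring
    · apply Finset.disjoint_filter_filter
      rw [Finset.disjoint_left]; intro x; simp only [Finset.mem_Icc, Finset.mem_Ico]; omega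

lemma npt_A_mono (m : ℕ) : Monotone (nptA m) := by
  intro a b h
  unfold nptA
  gcongr

lemma npt_A_le (m Y : ℕ) : nptA m Y ≤ Y := by
  unfold nptA
  exact (Finset.card_filter_le _ _).trans (by simp)

lemma npt_A_abs (m : ℕ) (hm : 0 < m) (Y : ℕ) :
    |(nptA m Y : ℝ) - (m.totient : ℝ) / m * Y| ≤ m.totient := by
  have h1 : nptA m (m * (Y / m)) ≤ nptA m Y := npt_A_mono m (Nat.mul_div_le Y m)
  have h2 : nptA m Y ≤ nptA m (m * (Y / m + 1)) := npt_A_mono m (Nat.lt_mul_div_succ Y hm).le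
  rw [npt_A_mul] at h1 h2
  have h1' : (m.totient : ℝ) * (Y / m : ℕ) ≤ nptA m Y := by exact_mod_cast h1
  have h2' : (nptA m Y : ℝ) ≤ (m.totient : ℝ) * ((Y / m : ℕ) + 1) := by exact_mod_cast h2
  have h3 : ((Y / m : ℕ) : ℝ) ≤ (Y : ℝ) / m := Nat.cast_div_le
  have h4 : (Y : ℝ) / m ≤ (Y / m : ℕ) + 1 := by
    rw [div_le_iff₀ (by exact_mod_cast hm)]
    have := (Nat.lt_mul_div_succ Y hm).le
    rw [mul_comm] at this
    exact_mod_cast this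
  have h5 : (m.totient : ℝ) / m * Y = m.totient * (Y / m) := by ring
  rw [h5, abs_le]
  have h0 : (0:ℝ) ≤ m.totient := by positivity
  constructor <;> nlinarith

lemma npt_A_tendsto (m : ℕ) (hm : 0 < m) (d : ℕ) :
    Tendsto (fun X : ℕ => (nptA m (X / d ^ 2) : ℝ) / X) atTop
      (𝓝 ((m.totient : ℝ) / m * (1 / d ^ 2))) := by
  rcases Nat.eq_zero_or_pos d with rfl | hd
  · simp [nptA]
  set a := (m.totient : ℝ) / m with ha
  have ha0 : 0 ≤ a := by positivity
  have hz : Tendsto (fun X : ℕ => ((m.totient : ℝ) + a) / X) atTop (𝓝 0) :=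
    tendsto_const_div_atTop_nhds_zero_nat _
  rw [tendsto_iff_norm_sub_tendsto_zero]
  refine squeeze_zero' (Eventually.of_forall fun _ => norm_nonneg _) ?_ hz
  filter_upwards [eventually_gt_atTop 0] with X hX
  have hX' : (0:ℝ) < X := by exact_mod_cast hX
  have hd' : (0:ℝ) < (d:ℝ) ^ 2 := by positivity
  have e : (nptA m (X / d ^ 2) : ℝ) / X - a * (1 / d ^ 2) =
      ((nptA m (X / d ^ 2) : ℝ) - a * (X / d ^ 2)) / X := by field_simp
  rw [e, Real.norm_eq_abs, abs_div, abs_of_pos hX']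
  gcongr
  have h := npt_A_abs m hm (X / d ^ 2)
  rw [← ha] at h
  have h3 : ((X / d ^ 2 : ℕ) : ℝ) ≤ (X : ℝ) / d ^ 2 := by exact_mod_cast (Nat.cast_div_le (α := ℝ) (m := X) (n := d ^ 2))
  have h4 : (X : ℝ) / d ^ 2 ≤ (X / d ^ 2 : ℕ) + 1 := by
    rw [div_le_iff₀ hd']
    have := (Nat.lt_mul_div_succ X (by positivity : 0 < d ^ 2)).le
    rw [mul_comm] at this
    exact_mod_cast this
  rw [abs_le] at h ⊢
  constructor <;> nlinarith

lemma npt_card_mult (m d Y : ℕ) (hd : 0 < d) (h : Nat.Coprime m d) :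
    ((Finset.Icc 1 Y).filter (fun n => Nat.Coprime m n ∧ d ^ 2 ∣ n)).card = nptA m (Y / d ^ 2) := by
  unfold nptA
  symm
  have hd2 : 0 < d ^ 2 := by positivity
  have hc : ∀ j, Nat.Coprime m (d ^ 2 * j) ↔ Nat.Coprime m j := by
    intro j
    rw [Nat.coprime_mul_iff_right]
    exact ⟨fun h => h.2, fun h' => ⟨Nat.Coprime.pow_right 2 h, h'⟩⟩
  apply Finset.card_bij (fun j _ => d ^ 2 * j)
  · intro j hj
    simp only [Finset.mem_filter, Finset.mem_Icc] at hj ⊢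
    refine ⟨⟨Nat.mul_pos hd2 hj.1.1, ?_⟩, (hc j).2 hj.2, dvd_mul_right _ _⟩
    rw [mul_comm]; exact (Nat.le_div_iff_mul_le hd2).1 hj.1.2
  · intro a _ b _ hab
    exact Nat.eq_of_mul_eq_mul_left hd2 hab
  · intro n hn
    simp only [Finset.mem_filter, Finset.mem_Icc] at hn
    obtain ⟨⟨h1, h2⟩, h3, j, rfl⟩ := hn
    refine ⟨j, ?_, rfl⟩
    simp only [Finset.mem_filter, Finset.mem_Icc]
    refine ⟨⟨Nat.pos_of_mul_pos_left h1, ?_⟩, (hc j).1 h3⟩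
    rw [Nat.le_div_iff_mul_le hd2, mul_comm]; exact h2

lemma npt_S_eq (m X : ℕ) :
    (nptS m X : ℝ) = ∑' d : ℕ, nptw m d * nptA m (X / d ^ 2) := by
  rw [tsum_eq_sum (s := Finset.Icc 1 X)]
  · unfold nptS
    rw [Finset.card_filter]
    push_cast
    have h1 : ∀ n ∈ Finset.Icc 1 X, (if Squarefree n ∧ Nat.Coprime m n then (1:ℝ) else 0) =
        ∑ d ∈ Finset.Icc 1 X, if (Nat.Coprime m n ∧ d ^ 2 ∣ n) then nptw m d else 0 := by
      intro n hn
      rw [Finset.mem_Icc] at hn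
      by_cases hc : Nat.Coprime m n
      · rw [if_congr (and_iff_left hc) rfl rfl, npt_sq_ind n hn.1, 
          Finset.sum_congr rfl (fun d _ => if_congr (and_iff_right (b := d ^ 2 ∣ n) hc) rfl rfl),
          ← Finset.sum_filter]
        have hs : n.divisors.filter (fun d => d ^ 2 ∣ n) = (Finset.Icc 1 X).filter (fun d => d ^ 2 ∣ n) := by
          ext d
          simp only [Finset.mem_filter, Nat.mem_divisors, Finset.mem_Icc, and_congr_left_iff]
          intro hd
          have hd' := (dvd_pow_self d two_ne_zero).trans hd
          have := Nat.le_of_dvd hn.1 hd'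
          have := Nat.pos_of_dvd_of_pos hd' hn.1
          constructor
          · intro _; omega
          · intro _; exact ⟨hd', by omega⟩
        rw [hs]
        apply Finset.sum_congr rfl
        intro d hd
        have : Nat.Coprime m d := Nat.Coprime.coprime_dvd_right
          ((dvd_pow_self d two_ne_zero).trans (Finset.mem_filter.1 hd).2) hc
        simp [nptw, this]
      · simp [hc]
    rw [Finset.sum_congr rfl h1, Finset.sum_comm]
    apply Finset.sum_congr rfl
    intro d hd
    rw [← Finset.sum_filter, Finset.sum_const, nsmul_eq_mul, mul_comm]
    by_cases hc : Nat.Coprime m d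
    · rw [npt_card_mult m d X (Finset.mem_Icc.1 hd).1 hc]
    · simp [nptw, hc]
  · intro d hd
    have : X / d ^ 2 = 0 := by
      rcases Nat.eq_zero_or_pos d with rfl | h0
      · simp
      · apply Nat.div_eq_of_lt
        simp only [Finset.mem_Icc, not_and, not_le] at hd
        have := hd h0
        nlinarith
    simp [this, nptA]

lemma npt_w_abs (m d : ℕ) : |nptw m d| ≤ 1 := by
  unfold nptw
  split_ifs
  · exact_mod_cast ArithmeticFunction.abs_moebius_le_one
  · simp

lemma npt_S_tendsto (m : ℕ) (hm : 0 < m) :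
    Tendsto (fun X : ℕ => (nptS m X : ℝ) / X) atTop
      (𝓝 (∑' d : ℕ, nptw m d * ((m.totient : ℝ) / m * (1 / d ^ 2)))) := by
  have e : (fun X : ℕ => (nptS m X : ℝ) / X) =
      fun X : ℕ => ∑' d : ℕ, nptw m d * ((nptA m (X / d ^ 2) : ℝ) / X) := by
    ext X
    rw [npt_S_eq, ← tsum_div_const]
    simp only [mul_div_assoc]
  rw [e]
  apply tendsto_tsum_of_dominated_convergence (bound := fun d : ℕ => 1 / (d:ℝ) ^ 2)
  · exact hasSum_zeta_two.summable
  · intro d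
    exact (npt_A_tendsto m hm d).const_mul _
  · filter_upwards [eventually_gt_atTop 0] with X hX d
    have hX' : (0:ℝ) < X := by exact_mod_cast hX
    rw [Real.norm_eq_abs, abs_mul, abs_of_nonneg (by positivity : 0 ≤ (nptA m (X / d ^ 2) : ℝ) / X)]
    have h1 : (nptA m (X / d ^ 2) : ℝ) / X ≤ 1 / d ^ 2 := by
      rw [div_le_iff₀ hX']
      calc (nptA m (X / d ^ 2) : ℝ) ≤ (X / d ^ 2 : ℕ) := by exact_mod_cast npt_A_le _ _
        _ ≤ (X : ℝ) / d ^ 2 := by exact_mod_cast (Nat.cast_div_le (α := ℝ) (m := X) (n := d ^ 2))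
        _ = _ := by ring
    calc _ ≤ 1 * ((nptA m (X / d ^ 2) : ℝ) / X) := by gcongr; exact npt_w_abs m d
      _ ≤ _ := by linarith

lemma npt_w_sum (m : ℕ) : 6 / Real.pi ^ 2 ≤ ∑' d : ℕ, nptw m d * (1 / (d:ℝ) ^ 2) := by
  have h := DirichletCharacter.LSeries.mul_mu_eq_one (N := m) 1 (s := 2) (by norm_num)
  have hchi : ∀ n : ℕ, (1 : DirichletCharacter ℂ m) (n : ZMod m) = if Nat.Coprime m n then 1 else 0 := by
    intro n
    split_ifs with hc
    · exact MulChar.one_apply ((ZMod.isUnit_iff_coprime n m).2 hc.symm)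
    · exact MulChar.map_nonunit _ (fun hu => hc ((ZMod.isUnit_iff_coprime n m).1 hu).symm)
  have hpow : ∀ n : ℕ, (n : ℂ) ^ (2 : ℂ) = ((n:ℝ) ^ 2 : ℝ) := by
    intro n; 
    rw [show (2:ℂ) = ((2:ℕ):ℂ) by norm_num, Complex.cpow_natCast]; push_cast; rfl
  have e1 : LSeries (fun n : ℕ => (1 : DirichletCharacter ℂ m) (n : ZMod m)) 2 =
      ((∑' n : ℕ, (if Nat.Coprime m n then 1 / (n:ℝ) ^ 2 else 0) : ℝ) : ℂ) := by
    rw [Complex.ofReal_tsum]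
    apply tsum_congr
    intro n
    rcases eq_or_ne n 0 with rfl | hn
    · simp
    rw [LSeries.term_of_ne_zero hn, hchi, hpow]
    split_ifs <;> simp
  have e2 : LSeries ((fun n : ℕ => (1 : DirichletCharacter ℂ m) (n : ZMod m)) *
      (fun n : ℕ => ((ArithmeticFunction.moebius n : ℤ) : ℂ))) 2 =
      ((∑' d : ℕ, nptw m d * (1 / (d:ℝ) ^ 2) : ℝ) : ℂ) := by
    rw [Complex.ofReal_tsum]
    apply tsum_congr
    intro n
    rcases eq_or_ne n 0 with rfl | hn
    · simp
    rw [LSeries.term_of_ne_zero hn, Pi.mul_apply, hchi, hpow, nptw]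
    split_ifs <;> simp [div_eq_mul_inv]
  rw [e1, e2] at h
  have h' : (∑' n : ℕ, (if Nat.Coprime m n then 1 / (n:ℝ) ^ 2 else 0)) * (∑' d : ℕ, nptw m d * (1 / (d:ℝ) ^ 2)) = 1 := by
    exact_mod_cast h
  set A := ∑' n : ℕ, (if Nat.Coprime m n then 1 / (n:ℝ) ^ 2 else 0)
  have hA0 : 0 ≤ A := tsum_nonneg (fun n => by split_ifs <;> positivity)
  have hA : A ≤ Real.pi ^ 2 / 6 := by
    rw [← hasSum_zeta_two.tsum_eq]
    have hle : ∀ n : ℕ, (if Nat.Coprime m n then 1 / (n:ℝ) ^ 2 else 0) ≤ 1 / (n:ℝ) ^ 2 := by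
      intro n; split_ifs
      · exact le_rfl
      · positivity
    refine Summable.tsum_le_tsum hle (Summable.of_nonneg_of_le (fun n => by split_ifs <;> positivity) hle hasSum_zeta_two.summable) hasSum_zeta_two.summable
  have hA1 : 0 < A := lt_of_le_of_ne hA0 (by intro h0; rw [← h0] at h'; simp at h')
  have hB : (∑' d : ℕ, nptw m d * (1 / (d:ℝ) ^ 2)) = 1 / A := by
    rw [eq_div_iff hA1.ne', mul_comm]; exact h'
  rw [hB, show 6 / Real.pi ^ 2 = 1 / (Real.pi ^ 2 / 6) by field_simp]
  gcongr

lemma npt_euler (s δ : ℝ) (hs : 1 < s) (hδ : 0 ≤ δ) (N : ℕ) :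
    ∏ p ∈ N.primesBelow, (1 + δ * (p:ℝ) ^ (-s)) ≤ (∑' n : ℕ, 1 / (n:ℝ) ^ s) ^ δ := by
  let f : ℕ →* ℝ :=
    { toFun := fun n => (n:ℝ) ^ (-s)
      map_one' := by simp
      map_mul' := fun a b => by push_cast; rw [Real.mul_rpow (by positivity) (by positivity)] }
  have hf : ∀ n, f n = (n:ℝ) ^ (-s) := fun n => rfl
  have hf0 : ∀ n, 0 ≤ f n := fun n => by rw [hf]; positivity
  have hsum : Summable f := Real.summable_nat_rpow.2 (by linarith)
  have h1 := EulerProduct.prod_primesBelow_geometric_eq_tsum_smoothNumbers hsum N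
  have h2 : ∑' m : N.smoothNumbers, f m ≤ ∑' n, f n :=
    Summable.tsum_subtype_le f _ hf0 hsum
  have h3 : ∑' n, f n = ∑' n : ℕ, 1 / (n:ℝ) ^ s := by
    apply tsum_congr
    intro n
    rw [hf, Real.rpow_neg (by positivity), one_div]
  have hlt : ∀ p ∈ N.primesBelow, f p < 1 := by
    intro p hp
    have := hsum.norm_lt_one (Nat.prime_of_mem_primesBelow hp).one_lt
    exact (le_abs_self _).trans_lt this
  rw [← h3]
  calc ∏ p ∈ N.primesBelow, (1 + δ * (p:ℝ) ^ (-s)) ≤ ∏ p ∈ N.primesBelow, ((1 - f p)⁻¹) ^ δ := by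
        apply Finset.prod_le_prod
        · intro p hp; positivity
        · intro p hp
          have h4 : 0 < 1 - f p := by linarith [hlt p hp]
          rw [← hf p]
          have h5 : Real.exp (f p) ≤ (1 - f p)⁻¹ := by
            rw [le_inv_comm₀ (Real.exp_pos _) h4, ← Real.exp_neg]
            linarith [Real.add_one_le_exp (-(f p))]
          calc 1 + δ * f p ≤ Real.exp (δ * f p) := by linarith [Real.add_one_le_exp (δ * f p)]
            _ = (Real.exp (f p)) ^ δ := by rw [← Real.exp_mul, mul_comm]
            _ ≤ _ := by gcongr
    _ = (∏ p ∈ N.primesBelow, (1 - f p)⁻¹) ^ δ := by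
        rw [Real.finsetProd_rpow]
        intro p hp
        have h4 : 0 < 1 - f p := by linarith [hlt p hp]
        positivity
    _ ≤ _ := by
        rw [h1]
        gcongr
        exact tsum_nonneg (fun m => hf0 m)

lemma npt_rankin (δ : ℝ) (hδ : 0 ≤ δ) (X : ℕ) (hX : 2 ≤ X) :
    ∑ n ∈ Finset.Icc 1 X, (1 + δ) ^ n.primeFactors.card ≤
      Real.exp 1 * X * ∏ p ∈ (X + 1).primesBelow, (1 + δ * (p:ℝ) ^ (-(1 + 1 / Real.log X))) := by
  have hXr : (1:ℝ) < X := by exact_mod_cast hX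
  have hlog : 0 < Real.log X := Real.log_pos hXr
  set s := 1 + 1 / Real.log X with hs
  set P := (X + 1).primesBelow with hP
  have h1 : ∀ n ∈ Finset.Icc 1 X, (1 + δ) ^ n.primeFactors.card =
      ∑ t ∈ P.powerset, if t ⊆ n.primeFactors then δ ^ t.card else 0 := by
    intro n hn
    rw [Finset.mem_Icc] at hn
    have hsub : n.primeFactors ⊆ P := by
      intro p hp
      rw [hP, Nat.mem_primesBelow]
      have := Nat.le_of_dvd hn.1 (Nat.dvd_of_mem_primeFactors hp)
      exact ⟨by omega, Nat.prime_of_mem_primeFactors hp⟩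
    rw [← Finset.prod_const, Finset.prod_one_add, ← Finset.sum_filter]
    have : P.powerset.filter (fun t => t ⊆ n.primeFactors) = n.primeFactors.powerset := by
      ext t
      simp only [Finset.mem_filter, Finset.mem_powerset]
      exact ⟨fun h => h.2, fun h => ⟨h.trans hsub, h⟩⟩
    rw [this]
    simp
  rw [Finset.sum_congr rfl h1, Finset.sum_comm, Finset.prod_one_add, Finset.mul_sum]
  apply Finset.sum_le_sum
  intro t ht
  rw [Finset.mem_powerset] at ht
  have htp : ∀ p ∈ t, p.Prime := fun p hp => Nat.prime_of_mem_primesBelow (ht hp)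
  set d := ∏ p ∈ t, p with hd
  have hd0 : 0 < d := Finset.prod_pos fun p hp => (htp p hp).pos
  rw [← Finset.sum_filter, Finset.sum_const, nsmul_eq_mul, Finset.prod_mul_distrib, Finset.prod_const,
    Real.finsetProd_rpow _ _ (fun p _ => by positivity), ← Nat.cast_prod, ← hd]
  have hcard : ((Finset.Icc 1 X).filter (fun n => t ⊆ n.primeFactors)).card ≤ X / d := by
    have : (Finset.Icc 1 X).filter (fun n => t ⊆ n.primeFactors) ⊆ (Finset.Ioc 0 X).filter (fun n => d ∣ n) := by
      intro n hn
      simp only [Finset.mem_filter, Finset.mem_Icc, Finset.mem_Ioc] at hn ⊢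
      refine ⟨by omega, ?_⟩
      exact (Finset.prod_dvd_prod_of_subset _ _ _ hn.2).trans (Nat.prod_primeFactors_dvd n)
    refine (Finset.card_le_card this).trans ?_
    rw [Nat.Ioc_filter_dvd_card_eq_div]
  have hmain : (((Finset.Icc 1 X).filter (fun n => t ⊆ n.primeFactors)).card : ℝ) ≤
      Real.exp 1 * X * (d:ℝ) ^ (-s) := by
    rcases le_or_gt d X with hdX | hdX
    · have hd' : (0:ℝ) < d := by exact_mod_cast hd0
      have hpow : (d:ℝ) ^ (1 / Real.log X) ≤ Real.exp 1 := by
        calc (d:ℝ) ^ (1 / Real.log X) ≤ (X:ℝ) ^ (1 / Real.log X) := by gcongr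
          _ = Real.exp 1 := by
            rw [Real.rpow_def_of_pos (by linarith)]; congr 1; field_simp
      calc _ ≤ ((X / d : ℕ) : ℝ) := by exact_mod_cast hcard
        _ ≤ (X:ℝ) / d := Nat.cast_div_le
        _ = (d:ℝ) ^ (1 / Real.log X) * X * (d:ℝ) ^ (-s) := by
            rw [hs, neg_add, Real.rpow_add hd', Real.rpow_neg hd'.le 1, Real.rpow_one, Real.rpow_neg hd'.le]
            have := (Real.rpow_pos_of_pos hd' (1 / Real.log X)).ne'
            generalize (d:ℝ) ^ (1 / Real.log X) = y at *
            field_simp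
        _ ≤ _ := by gcongr
    · rw [Nat.div_eq_of_lt hdX] at hcard
      have : ((Finset.Icc 1 X).filter (fun n => t ⊆ n.primeFactors)).card = 0 := by omega
      rw [this]
      push_cast
      positivity
  calc _ ≤ (Real.exp 1 * X * (d:ℝ) ^ (-s)) * δ ^ t.card := by gcongr
    _ = _ := by ring

noncomputable def nptB (δ : ℝ) (X : ℕ) : ℕ :=
  ((Finset.Icc 1 X).filter (fun n : ℕ => Squarefree n ∧
    (1 + δ) * Real.log (Real.log n) < n.primeFactorsList.length)).card

lemma npt_c_pos (δ : ℝ) (hδ : 0 < δ) : 0 < (1 + δ) * Real.log (1 + δ) - δ := by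
  have h1 := Real.log_lt_sub_one_of_pos (x := (1 + δ)⁻¹) (by positivity)
    (by intro h; rw [inv_eq_one] at h; linarith)
  rw [Real.log_inv] at h1
  have h2 : (1 + δ) * (1 + δ)⁻¹ = 1 := mul_inv_cancel₀ (by positivity)
  nlinarith

lemma npt_B_bound (δ : ℝ) (hδ : 0 < δ) : ∀ᶠ X : ℕ in atTop,
    (nptB δ X : ℝ) ≤ Real.sqrt X + X * Real.exp (1 + δ * Real.log 2 + (1 + δ) * Real.log (1 + δ) * Real.log 2
      - ((1 + δ) * Real.log (1 + δ) - δ) * Real.log (Real.log X)) := by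
  have ht : Tendsto (fun n : ℕ => Real.log (n : ℝ)) atTop atTop :=
    Real.tendsto_log_atTop.comp tendsto_natCast_atTop_atTop
  have hs1 : Tendsto (fun X : ℕ => 1 + 1 / Real.log (X:ℝ)) atTop (𝓝[>] 1) := by
    rw [tendsto_nhdsWithin_iff]
    constructor
    · have : Tendsto (fun X : ℕ => 1 / Real.log (X:ℝ)) atTop (𝓝 0) := by
        simp only [one_div]; exact ht.inv_tendsto_atTop
      simpa using this.const_add 1
    · filter_upwards [ht.eventually_gt_atTop 0] with X hX
      simp only [Set.mem_Ioi]
      have : 0 < 1 / Real.log (X:ℝ) := by positivity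
      linarith
  have hz := (tendsto_sub_mul_tsum_nat_rpow.comp hs1).eventually_le_const (show (1:ℝ) < 2 by norm_num)
  filter_upwards [hz, ht.eventually_ge_atTop 2, eventually_ge_atTop 2] with X hz hl hX
  have hXr : (1:ℝ) < X := by exact_mod_cast hX
  set L := Real.log (X:ℝ) with hL
  have hL0 : 0 < L := by linarith
  simp only [Function.comp] at hz
  set Z := ∑' n : ℕ, 1 / (n:ℝ) ^ (1 + 1 / L) with hZ
  have hZ0 : 0 ≤ Z := tsum_nonneg (fun n => by positivity)
  have hZ2 : Z ≤ 2 * L := by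
    have : (1 + 1 / L - 1) * Z = Z / L := by ring
    rw [this, div_le_iff₀ hL0] at hz
    exact hz
  have hR := npt_rankin δ hδ.le X hX
  have hE := npt_euler (1 + 1 / L) δ (by have : 0 < 1 / L := by positivity
                                         linarith) hδ.le (X + 1)
  rw [← hL] at hR
  have hprod : ∏ p ∈ (X + 1).primesBelow, (1 + δ * (p:ℝ) ^ (-(1 + 1 / L))) ≤
      Real.exp (δ * (Real.log 2 + Real.log L)) := by
    refine hE.trans ?_
    calc Z ^ δ ≤ (2 * L) ^ δ := by gcongr
      _ = _ := by
        rw [Real.rpow_def_of_pos (by positivity), Real.log_mul (by norm_num) hL0.ne', mul_comm]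
  set W := Real.exp ((1 + δ) * Real.log (1 + δ) * (Real.log L - Real.log 2)) with hW
  have hlog1 : 0 < Real.log (1 + δ) := Real.log_pos (by linarith)
  set G := (Finset.Icc 1 X).filter (fun n => W ≤ (1 + δ) ^ n.primeFactors.card) with hG
  have hsub : (Finset.Icc 1 X).filter (fun n : ℕ => Squarefree n ∧
    (1 + δ) * Real.log (Real.log n) < n.primeFactorsList.length) ⊆ Finset.Icc 1 (Nat.sqrt X) ∪ G := by
    intro n hn
    simp only [hG, Finset.mem_filter, Finset.mem_Icc, Finset.mem_union] at hn ⊢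
    obtain ⟨⟨h1, h2⟩, hsq, hlen⟩ := hn
    rcases le_or_gt n (Nat.sqrt X) with h | h
    · exact Or.inl ⟨h1, h⟩
    · right
      refine ⟨⟨h1, h2⟩, ?_⟩
      rw [Nat.sqrt_lt'] at h
      have hn0 : (0:ℝ) < n := by exact_mod_cast h1
      have hlogn : L / 2 ≤ Real.log n := by
        have : L ≤ Real.log ((n:ℝ) ^ 2) :=
          Real.log_le_log (by linarith) (by exact_mod_cast h.le)
        rw [Real.log_pow] at this
        push_cast at this
        linarith
      have hll : Real.log L - Real.log 2 ≤ Real.log (Real.log n) := by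
        rw [← Real.log_div hL0.ne' (by norm_num)]
        exact Real.log_le_log (by positivity) hlogn
      rw [npt_len hsq] at hlen
      rw [← Real.rpow_natCast, Real.rpow_def_of_pos (by linarith), hW]
      apply Real.exp_le_exp.2
      calc _ = Real.log (1 + δ) * ((1 + δ) * (Real.log L - Real.log 2)) := by ring
        _ ≤ Real.log (1 + δ) * ((1 + δ) * Real.log (Real.log n)) := by gcongr
        _ ≤ _ := by gcongr
  have hB : nptB δ X ≤ Nat.sqrt X + G.card := by
    unfold nptB
    refine (Finset.card_le_card hsub).trans ((Finset.card_union_le _ _).trans ?_)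
    simp
  have hGW : (G.card : ℝ) * W ≤ Real.exp 1 * X * Real.exp (δ * (Real.log 2 + Real.log L)) := by
    calc (G.card : ℝ) * W = ∑ n ∈ G, W := by simp
      _ ≤ ∑ n ∈ G, (1 + δ) ^ n.primeFactors.card :=
          Finset.sum_le_sum (fun n hn => (Finset.mem_filter.1 hn).2)
      _ ≤ ∑ n ∈ Finset.Icc 1 X, (1 + δ) ^ n.primeFactors.card :=
          Finset.sum_le_sum_of_subset_of_nonneg (Finset.filter_subset _ _) (fun _ _ _ => by positivity)
      _ ≤ _ := hR
      _ ≤ _ := by gcongr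
  have hG2 : (G.card : ℝ) ≤ X * Real.exp (1 + δ * Real.log 2 + (1 + δ) * Real.log (1 + δ) * Real.log 2
      - ((1 + δ) * Real.log (1 + δ) - δ) * Real.log L) := by
    have hW0 : 0 < W := Real.exp_pos _
    refine le_of_mul_le_mul_right (hGW.trans (le_of_eq ?_)) hW0
    rw [mul_assoc (X:ℝ), hW, ← Real.exp_add, mul_comm (Real.exp 1), mul_assoc, ← Real.exp_add]
    congr 2
    ring
  have hsqrt : ((Nat.sqrt X : ℕ) : ℝ) ≤ Real.sqrt X := Real.nat_sqrt_le_real_sqrt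
  have hB' : (nptB δ X : ℝ) ≤ Nat.sqrt X + G.card := by exact_mod_cast hB
  linarith

lemma npt_B_tendsto (δ : ℝ) (hδ : 0 < δ) :
    Tendsto (fun X : ℕ => (nptB δ X : ℝ) / X) atTop (𝓝 0) := by
  have ht : Tendsto (fun n : ℕ => Real.log (n : ℝ)) atTop atTop :=
    Real.tendsto_log_atTop.comp tendsto_natCast_atTop_atTop
  have htt := Real.tendsto_log_atTop.comp ht
  have hc := npt_c_pos δ hδ
  have h1 : Tendsto (fun X : ℕ => Real.exp (1 + δ * Real.log 2 + (1 + δ) * Real.log (1 + δ) * Real.log 2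
      - ((1 + δ) * Real.log (1 + δ) - δ) * Real.log (Real.log X))) atTop (𝓝 0) := by
    apply Real.tendsto_exp_atBot.comp
    simp only [sub_eq_add_neg _ (_ * Real.log (Real.log _))]
    apply tendsto_atBot_add_const_left
    apply tendsto_neg_atTop_atBot.comp
    exact htt.const_mul_atTop hc
  have h2 : Tendsto (fun X : ℕ => (Real.sqrt (X:ℝ))⁻¹) atTop (𝓝 0) :=
    (Real.tendsto_sqrt_atTop.comp tendsto_natCast_atTop_atTop).inv_tendsto_atTop
  have h3 := h2.add h1
  rw [add_zero] at h3
  refine squeeze_zero' (Eventually.of_forall fun _ => by positivity) ?_ h3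
  filter_upwards [npt_B_bound δ hδ, eventually_gt_atTop 0] with X hb hX
  have hX' : (0:ℝ) < X := by exact_mod_cast hX
  rw [div_le_iff₀ hX']
  refine hb.trans (le_of_eq ?_)
  have : Real.sqrt X * Real.sqrt X = X := Real.mul_self_sqrt hX'.le
  have hs : 0 < Real.sqrt X := Real.sqrt_pos.2 hX'
  have h5 : (Real.sqrt X)⁻¹ * X = Real.sqrt X := by
    rw [inv_mul_eq_div, div_eq_iff hs.ne', this]
  rw [add_mul (Real.sqrt X)⁻¹, h5]
  ring

lemma npt_div_tendsto (m : ℕ) (hm : 0 < m) :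
    Tendsto (fun x : ℕ => ((x / m : ℕ) : ℝ) / x) atTop (𝓝 (1 / (m:ℝ))) := by
  have hm' : (0:ℝ) < m := by exact_mod_cast hm
  have hz : Tendsto (fun x : ℕ => (1:ℝ) / x) atTop (𝓝 0) := tendsto_const_div_atTop_nhds_zero_nat _
  rw [tendsto_iff_norm_sub_tendsto_zero]
  refine squeeze_zero' (Eventually.of_forall fun _ => norm_nonneg _) ?_ hz
  filter_upwards [eventually_gt_atTop 0] with X hX
  have hX' : (0:ℝ) < X := by exact_mod_cast hX
  have e : ((X / m : ℕ) : ℝ) / X - 1 / m = (((X / m : ℕ) : ℝ) - X / m) / X := by field_simp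
  rw [e, Real.norm_eq_abs, abs_div, abs_of_pos hX']
  gcongr
  have h3 : ((X / m : ℕ) : ℝ) ≤ (X : ℝ) / m := Nat.cast_div_le
  have h4 : (X : ℝ) / m ≤ (X / m : ℕ) + 1 := by
    rw [div_le_iff₀ hm']
    have := (Nat.lt_mul_div_succ X hm).le
    rw [mul_comm] at this
    exact_mod_cast this
  rw [abs_le]
  constructor <;> linarith

lemma npt_count (δ : ℝ) (m N₀ : ℕ) (hm : 0 < m) (P : ℕ → Prop) [DecidablePred P]
    (h : ∀ m' : ℕ, N₀ ≤ m' → Squarefree m' → Nat.Coprime m m' →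
        (m'.primeFactorsList.length : ℝ) ≤ (1 + δ) * Real.log (Real.log m') → P (m * m')) (x : ℕ) :
    nptS m (x / m) ≤ ((Finset.Icc 1 x).filter P).card + N₀ + nptB δ (x / m) := by
  classical
  set T := ((Finset.Icc 1 x).filter P) with hT
  set U := (Finset.Icc 1 (x / m)).filter (fun n => P (m * n)) with hU
  have hUT : U.card ≤ T.card := by
    apply Finset.card_le_card_of_injOn (fun n => m * n)
    · intro n hn
      simp only [hU, hT, Finset.coe_filter, Finset.mem_Icc, Set.mem_setOf_eq] at hn ⊢
      refine ⟨⟨Nat.mul_pos hm hn.1.1, ?_⟩, hn.2⟩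
      rw [mul_comm]
      exact (Nat.le_div_iff_mul_le hm).1 hn.1.2
    · intro a _ b _ hab
      exact Nat.eq_of_mul_eq_mul_left hm hab
  have hsub : (Finset.Icc 1 (x / m)).filter (fun n => Squarefree n ∧ Nat.Coprime m n) ⊆
      (U ∪ Finset.range N₀) ∪ (Finset.Icc 1 (x / m)).filter (fun n : ℕ => Squarefree n ∧
        (1 + δ) * Real.log (Real.log n) < n.primeFactorsList.length) := by
    intro n hn
    simp only [hU, Finset.mem_filter, Finset.mem_union, Finset.mem_range] at hn ⊢
    by_cases h1 : n < N₀
    · exact Or.inl (Or.inr h1)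
    by_cases h2 : (1 + δ) * Real.log (Real.log n) < n.primeFactorsList.length
    · exact Or.inr ⟨hn.1, hn.2.1, h2⟩
    · exact Or.inl (Or.inl ⟨hn.1, h n (not_lt.1 h1) hn.2.1 hn.2.2 (not_lt.1 h2)⟩)
  have h3 := Finset.card_le_card hsub
  have h4 := Finset.card_union_le (U ∪ Finset.range N₀) ((Finset.Icc 1 (x / m)).filter
    (fun n : ℕ => Squarefree n ∧ (1 + δ) * Real.log (Real.log n) < n.primeFactorsList.length))
  have h5 := Finset.card_union_le U (Finset.range N₀)
  rw [Finset.card_range] at h5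
  unfold nptS nptB
  convert (h3.trans h4).trans (Nat.add_le_add_right (h5.trans (Nat.add_le_add_right hUT N₀)) _) using 2

lemma npt_density (δ : ℝ) (hδ : 0 < δ) (m N₀ : ℕ) (hm : 0 < m) (P : ℕ → Prop) [DecidablePred P]
    (h : ∀ m' : ℕ, N₀ ≤ m' → Squarefree m' → Nat.Coprime m m' →
        (m'.primeFactorsList.length : ℝ) ≤ (1 + δ) * Real.log (Real.log m') → P (m * m')) :
    6 / Real.pi ^ 2 * (Nat.totient m) / (m : ℝ) ^ 2 ≤
      liminf (fun x : ℕ => (((Finset.Icc 1 x).filter P).card : ℝ) / x) atTop := by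
  have hm' : (0:ℝ) < m := by exact_mod_cast hm
  have hX : Tendsto (fun x : ℕ => x / m) atTop atTop := Nat.tendsto_div_const_atTop hm.ne'
  set ρ := ∑' d : ℕ, nptw m d * ((m.totient : ℝ) / m * (1 / d ^ 2)) with hρ
  have hρ' : (m.totient : ℝ) / m * (6 / Real.pi ^ 2) ≤ ρ := by
    have : ρ = (m.totient : ℝ) / m * ∑' d : ℕ, nptw m d * (1 / (d:ℝ) ^ 2) := by
      rw [hρ, ← tsum_mul_left]
      apply tsum_congr; intro d; ring
    rw [this]
    gcongr
    exact npt_w_sum m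
  have hg : Tendsto (fun x : ℕ => ((nptS m (x / m) : ℝ) / (x / m : ℕ) - (nptB δ (x / m) : ℝ) / (x / m : ℕ)) *
      (((x / m : ℕ) : ℝ) / x) - (N₀ : ℝ) / x) atTop (𝓝 ((ρ - 0) * (1 / m) - 0)) :=
    ((((npt_S_tendsto m hm).comp hX).sub ((npt_B_tendsto δ hδ).comp hX)).mul (npt_div_tendsto m hm)).sub
      (tendsto_const_div_atTop_nhds_zero_nat _)
  have hle : (fun x : ℕ => ((nptS m (x / m) : ℝ) / (x / m : ℕ) - (nptB δ (x / m) : ℝ) / (x / m : ℕ)) *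
      (((x / m : ℕ) : ℝ) / x) - (N₀ : ℝ) / x) ≤ᶠ[atTop]
      (fun x : ℕ => (((Finset.Icc 1 x).filter P).card : ℝ) / x) := by
    filter_upwards [hX.eventually_gt_atTop 0, eventually_gt_atTop 0] with x h1 h2
    have h1' : (0:ℝ) < (x / m : ℕ) := by exact_mod_cast h1
    have h2' : (0:ℝ) < x := by exact_mod_cast h2
    have hc : (nptS m (x / m) : ℝ) ≤ ((Finset.Icc 1 x).filter P).card + N₀ + nptB δ (x / m) := by
      exact_mod_cast npt_count δ m N₀ hm P h x
    have e : ((nptS m (x / m) : ℝ) / (x / m : ℕ) - (nptB δ (x / m) : ℝ) / (x / m : ℕ)) *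
      (((x / m : ℕ) : ℝ) / x) - (N₀ : ℝ) / x =
        ((nptS m (x / m) : ℝ) - nptB δ (x / m) - N₀) / x := by
      generalize ((x / m : ℕ) : ℝ) = y at *
      field_simp
    rw [e]
    gcongr
    linarith
  have hcob : IsCoboundedUnder (· ≥ ·) atTop
      (fun x : ℕ => (((Finset.Icc 1 x).filter P).card : ℝ) / x) := by
    apply IsBoundedUnder.isCoboundedUnder_ge
    refine isBoundedUnder_of ⟨1, fun x => ?_⟩
    apply div_le_one_of_le₀ _ (by positivity)
    exact_mod_cast (Finset.card_filter_le _ _).trans (by simp)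
  have hlim := liminf_le_liminf hle hg.isBoundedUnder_ge hcob
  rw [hg.liminf_eq] at hlim
  refine le_trans ?_ hlim
  calc 6 / Real.pi ^ 2 * (Nat.totient m) / (m : ℝ) ^ 2
      = ((m.totient : ℝ) / m * (6 / Real.pi ^ 2)) * (1 / m) := by field_simp
    _ ≤ ρ * (1 / m) := by gcongr
    _ = _ := by ring

end npt

open Classical in
theorem near_perfect_threshold_lower_density (ε : ℝ) (hε : 0 < ε) (hε1 : ε < 1)
    (k : ℕ) (m : ℕ) (hm : 0 < m)
    (hmk : ∃ D ⊆ m.properDivisors, D.card ≤ k ∧ ArithmeticFunction.sigma 1 m = 2 * m + ∑ d ∈ D, d) :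
    (∃ N₀ : ℕ, ∀ m' : ℕ, N₀ ≤ m' → Squarefree m' → Nat.Coprime m m' →
        (m'.primeFactorsList.length : ℝ) ≤
          (1 + ε / (2 * Real.log 2)) * Real.log (Real.log m') →
        ∃ D ⊆ (m * m').properDivisors,
          (D.card : ℝ) ≤ (Real.log (m * m')) ^ (Real.log 2 + ε) ∧
          ArithmeticFunction.sigma 1 (m * m') = 2 * (m * m') + ∑ d ∈ D, d) ∧
    (6 / Real.pi ^ 2 * (Nat.totient m) / (m : ℝ) ^ 2 ≤
      Filter.liminf (fun x : ℕ =>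
        (((Finset.Icc 1 x).filter (fun n : ℕ => ∃ D ⊆ n.properDivisors,
            (D.card : ℝ) ≤ (Real.log n) ^ (Real.log 2 + ε) ∧
            ArithmeticFunction.sigma 1 n = 2 * n + ∑ d ∈ D, d)).card : ℝ) / x) Filter.atTop) := by
  have h1 := npt_part1 ε hε k m hm hmk
  refine ⟨h1, ?_⟩
  obtain ⟨N₀, hN⟩ := h1
  have hδ : 0 < ε / (2 * Real.log 2) := by
    have := Real.log_pos (by norm_num : (1:ℝ) < 2)
    positivity
  apply npt_density (ε / (2 * Real.log 2)) hδ m N₀ hm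
  intro m' h2 h3 h4 h5
  obtain ⟨D, hD, hc, hs⟩ := hN m' h2 h3 h4 h5
  refine ⟨D, hD, ?_, hs⟩
  push_cast
  exact hc
end
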